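/- Let H be a separable infinite-dimensional complex Hilbert space, T1 and T2 bounded operators on H, and λ ≥ 1. If T2 lies in the norm closure of the set {S T1 S⁻¹ : S is an invertible bounded operator on H with ‖S‖·‖S⁻¹‖ ≤ λ}, then there exist bounded operators T1' and T2' on H such that T1 is approximately unitarily equivalent to T1', T1' is λ-similar to T2' (i.e., T2' = S T1' S⁻¹ for some invertible S with ‖S‖·‖S⁻¹‖ ≤ λ), and T2' is approximately unitarily equivalent to T2. -/

import Mathlib

open Filter Topology ContinuousLinearMap

/-- Conjugation of an operator by a unitary (linear isometric equivalence): `W T W*`. -/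
noncomputable def conjOp {H₁ H₂ : Type*} [NormedAddCommGroup H₁] [InnerProductSpace ℂ H₁]
    [NormedAddCommGroup H₂] [InnerProductSpace ℂ H₂]
    (W : H₁ ≃ₗᵢ[ℂ] H₂) (T : H₁ →L[ℂ] H₁) : H₂ →L[ℂ] H₂ :=
  ((W.toContinuousLinearEquiv : H₁ →L[ℂ] H₂).comp T).comp
    ((W.symm.toContinuousLinearEquiv : H₂ →L[ℂ] H₁))

/-- The restriction of an operator to an invariant subspace. -/
noncomputable def opRestrict {H : Type*} [NormedAddCommGroup H] [InnerProductSpace ℂ H]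
    (T : H →L[ℂ] H) (M : Submodule ℂ H) (hM : ∀ x ∈ M, T x ∈ M) : M →L[ℂ] M :=
  { toLinearMap := (T : H →ₗ[ℂ] H).restrict hM
    cont := Continuous.subtype_mk (T.continuous.comp continuous_subtype_val) _ }

/-- Two operators (possibly on different Hilbert spaces) are *compalent* if one is a compact
perturbation of a unitary conjugate of the other: `T₂ = W T₁ W* + K` with `K` compact. -/
def Compalent {H₁ H₂ : Type*} [NormedAddCommGroup H₁] [InnerProductSpace ℂ H₁]
    [NormedAddCommGroup H₂] [InnerProductSpace ℂ H₂]
    (T₁ : H₁ →L[ℂ] H₁) (T₂ : H₂ →L[ℂ] H₂) : Prop :=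
  ∃ W : H₁ ≃ₗᵢ[ℂ] H₂, IsCompactOperator (T₂ - conjOp W T₁)

/-- `S` is compalent to a reducing part of `T`, that is, to the restriction of `T` to a closed
subspace invariant under both `T` and `T*`. -/
def CompalentToReducingPart {H : Type*} [NormedAddCommGroup H] [InnerProductSpace ℂ H]
    [CompleteSpace H] (S T : H →L[ℂ] H) : Prop :=
  ∃ (M : Submodule ℂ H) (_ : IsClosed (M : Set H))
    (hT : ∀ x ∈ M, T x ∈ M) (_ : ∀ x ∈ M, ContinuousLinearMap.adjoint T x ∈ M),
    Compalent S (opRestrict T M hT)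

/-- Two operators are approximately unitarily equivalent if there is a sequence of unitaries
`Wₙ` with `T₂ - Wₙ T₁ Wₙ*` compact for all `n` and `‖T₂ - Wₙ T₁ Wₙ*‖ → 0`. -/
def ApproxUnitEquiv {H : Type*} [NormedAddCommGroup H] [InnerProductSpace ℂ H]
    (T₁ T₂ : H →L[ℂ] H) : Prop :=
  ∃ W : ℕ → (H ≃ₗᵢ[ℂ] H),
    (∀ n, IsCompactOperator (T₂ - conjOp (W n) T₁)) ∧
    Filter.Tendsto (fun n => ‖T₂ - conjOp (W n) T₁‖) Filter.atTop (nhds 0)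

/-- The set of operators of the form `S T₁ S⁻¹` with `S` invertible and
`‖S‖ ‖S⁻¹‖ ≤ lam`. -/
def boundedSimOrbit {H : Type*} [NormedAddCommGroup H] [InnerProductSpace ℂ H]
    (T₁ : H →L[ℂ] H) (lam : ℝ) : Set (H →L[ℂ] H) :=
  {A | ∃ S : H ≃L[ℂ] H, ‖(S : H →L[ℂ] H)‖ * ‖(S.symm : H →L[ℂ] H)‖ ≤ lam ∧
    A = ((S : H →L[ℂ] H).comp T₁).comp (S.symm : H →L[ℂ] H)}

set_option linter.deprecated false
set_option linter.unusedVariables false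

set_option linter.unusedSimpArgs false
set_option linter.unusedSectionVars false

noncomputable def cutψ (t : ℝ) : ℝ := Real.cos (max (-(Real.pi/2)) (min (Real.pi/2) (Real.pi/2*t)))

lemma cutψ_lip (s t : ℝ) : |cutψ s - cutψ t| ≤ 2 * |s - t| := by
  have h1 : |cutψ s - cutψ t| ≤ |max (-(Real.pi/2)) (min (Real.pi/2) (Real.pi/2*s)) -
      max (-(Real.pi/2)) (min (Real.pi/2) (Real.pi/2*t))| := by
    have := Real.lipschitzWith_cos.dist_le_mul (max (-(Real.pi/2)) (min (Real.pi/2) (Real.pi/2*s)))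
      (max (-(Real.pi/2)) (min (Real.pi/2) (Real.pi/2*t)))
    simpa [Real.dist_eq, cutψ] using this
  have h2 : |max (-(Real.pi/2)) (min (Real.pi/2) (Real.pi/2*s)) -
      max (-(Real.pi/2)) (min (Real.pi/2) (Real.pi/2*t))| ≤ |min (Real.pi/2) (Real.pi/2*s) - min (Real.pi/2) (Real.pi/2*t)| := by
    rw [max_comm, max_comm (-(Real.pi/2))]
    exact abs_max_sub_max_le_abs _ _ _
  have h3 : |min (Real.pi/2) (Real.pi/2*s) - min (Real.pi/2) (Real.pi/2*t)| ≤ |Real.pi/2*s - Real.pi/2*t| := by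

    exact (abs_min_sub_min_le_max _ _ _ _).trans (by simp)
  have h4 : |Real.pi/2*s - Real.pi/2*t| = Real.pi/2 * |s-t| := by
    rw [← mul_sub, abs_mul, abs_of_pos (by positivity)]
  have h5 : Real.pi/2 * |s-t| ≤ 2 * |s-t| := by
    have := Real.pi_le_four
    gcongr; linarith
  linarith

lemma cutψ_zero_right {t : ℝ} (h : 1 ≤ t) : cutψ t = 0 := by
  have hp := Real.pi_pos
  have : Real.pi/2 ≤ Real.pi/2*t := by nlinarith
  unfold cutψ
  rw [min_eq_left this, max_eq_right (by linarith), Real.cos_pi_div_two]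

lemma cutψ_zero_left {t : ℝ} (h : t ≤ -1) : cutψ t = 0 := by
  have hp := Real.pi_pos
  have : Real.pi/2*t ≤ -(Real.pi/2) := by nlinarith
  unfold cutψ
  rw [min_eq_right (by linarith), max_eq_left this, Real.cos_neg, Real.cos_pi_div_two]

lemma cutψ_mid {t : ℝ} (h : -1 ≤ t) (h' : t ≤ 1) : cutψ t = Real.cos (Real.pi/2*t) := by
  have hp := Real.pi_pos
  unfold cutψ
  rw [min_eq_right (by nlinarith), max_eq_right (by nlinarith)]

lemma cutψ_hasSum {t : ℝ} (ht : 0 ≤ t) : HasSum (fun k : ℕ => cutψ (t - k)^2) 1 := by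
  set m := ⌊t⌋₊ with hm
  have h1 : (m:ℝ) ≤ t := Nat.floor_le ht
  have h2 : t < m + 1 := Nat.lt_floor_add_one t
  have key : ∑ k ∈ ({m, m+1} : Finset ℕ), cutψ (t - k)^2 = 1 := by
    rw [Finset.sum_pair (by omega), cutψ_mid (by linarith) (by linarith),
      cutψ_mid (by push_cast; linarith) (by push_cast; linarith)]
    have : Real.pi/2*(t - ((m+1 : ℕ):ℝ)) = Real.pi/2*(t-m) - Real.pi/2 := by push_cast; ring
    rw [this, Real.cos_sub_pi_div_two]
    exact Real.cos_sq_add_sin_sq _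
  rw [← key]
  apply hasSum_sum_of_ne_finset_zero
  intro k hk
  simp only [Finset.mem_insert, Finset.mem_singleton, not_or] at hk
  rcases lt_or_gt_of_ne hk.1 with h | h
  · have : (k:ℝ) + 1 ≤ m := by exact_mod_cast h
    rw [cutψ_zero_right (by linarith)]; simp
  · have h' : m + 2 ≤ k := by omega
    have : (m:ℝ) + 2 ≤ k := by exact_mod_cast h'
    rw [cutψ_zero_left (by linarith)]; simp

lemma exists_cutoff (ε : ℝ) (hε : 0 < ε) : ∃ φ : ℕ → ℕ → ℝ,
    (∀ k, ∃ N, ∀ i, N ≤ i → φ k i = 0) ∧ (∀ i, HasSum (fun k => φ k i ^ 2) 1) ∧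
    (∀ k i, |φ k i - φ k (i+1)| ≤ ε * (1/2)^k) := by
  obtain ⟨a, ha0, ha1, ha2⟩ : ∃ a : ℝ, 0 < a ∧ a ≤ 1 ∧ 8 * a ≤ ε :=
    ⟨min 1 (ε/8), by positivity, min_le_left _ _, by linarith [min_le_right 1 (ε/8)]⟩
  set θ : ℕ → ℝ := fun i => a * Real.log (1 + i) with hθ
  have hθ0 : ∀ i, 0 ≤ θ i := fun i => mul_nonneg ha0.le (Real.log_nonneg (by linarith [Nat.cast_nonneg (α := ℝ) i]))
  have hθi : ∀ i, 0 ≤ θ (i+1) - θ i ∧ θ (i+1) - θ i ≤ a / (1 + i) := by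
    intro i
    have hi : (0:ℝ) < 1 + i := by positivity
    have e : θ (i+1) - θ i = a * Real.log (1 + 1/(1+i)) := by
      simp only [hθ]
      rw [← mul_sub, ← Real.log_div (by positivity) (by positivity)]
      congr 2; push_cast; field_simp; ring
    rw [e]
    constructor
    · apply mul_nonneg ha0.le (Real.log_nonneg _)
      have : (0:ℝ) ≤ 1/(1+i) := by positivity
      linarith
    · have := Real.log_le_sub_one_of_pos (x := 1 + 1/(1+(i:ℝ))) (by positivity)
      have : Real.log (1 + 1/(1+(i:ℝ))) ≤ 1/(1+i) := by linarith
      calc _ ≤ a * (1/(1+i)) := by gcongr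
        _ = _ := by ring
  have hlim : Tendsto θ atTop atTop := by
    apply Tendsto.const_mul_atTop ha0
    exact Real.tendsto_log_atTop.comp (tendsto_atTop_add_const_left _ _ tendsto_natCast_atTop_atTop)
  refine ⟨fun k i => cutψ (θ i - k), ?_, fun i => cutψ_hasSum (hθ0 i), ?_⟩
  · intro k
    obtain ⟨N, hN⟩ := (hlim.eventually_ge_atTop ((k:ℝ)+1)).exists_forall_of_atTop
    exact ⟨N, fun i hi => cutψ_zero_right (by linarith [hN i hi])⟩
  · intro k i
    show |cutψ (θ i - k) - cutψ (θ (i+1) - k)| ≤ _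
    by_cases hk : θ (i+1) - k ≤ -1
    · rw [cutψ_zero_left hk, cutψ_zero_left (by linarith [(hθi i).1])]
      simp; positivity
    · push Not at hk
      have h1 := cutψ_lip (θ i - k) (θ (i+1) - k)
      have h2 : |θ i - k - (θ (i+1) - k)| ≤ a / (1+i) := by
        rw [abs_le]; constructor <;> linarith [(hθi i).1, (hθi i).2, show 0 ≤ a/(1+(i:ℝ)) by positivity]
      have hi : (0:ℝ) < 1 + i := by positivity
      have h3 : θ (i+1) ≤ θ i + 1 := by
        have : a/(1+(i:ℝ)) ≤ 1 := by
          rw [div_le_one hi]; linarith [Nat.cast_nonneg (α := ℝ) i]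
        linarith [(hθi i).2]
      have h4 : (k:ℝ) ≤ θ i + 2 := by linarith
      have h5 : (2:ℝ)^k ≤ 4 * (1 + i) := by
        have : (2:ℝ)^k = (2:ℝ)^(k:ℝ) := by simp
        rw [this]
        calc (2:ℝ)^(k:ℝ) ≤ (2:ℝ)^(θ i + 2) := Real.rpow_le_rpow_of_exponent_le (by norm_num) h4
          _ = 4 * (2:ℝ)^(θ i) := by rw [Real.rpow_add (by norm_num)]; norm_num; ring
          _ ≤ 4 * (1 + i) := by
            gcongr
            rw [Real.rpow_def_of_pos (by norm_num)]
            rw [← Real.le_log_iff_exp_le hi]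
            have l2 : Real.log 2 ≤ 1 := by linarith [Real.log_two_lt_d9]
            have l20 : 0 ≤ Real.log 2 := Real.log_nonneg (by norm_num)
            have lg : 0 ≤ Real.log (1+i) := Real.log_nonneg (by linarith [Nat.cast_nonneg (α := ℝ) i])
            have : θ i ≤ Real.log (1+i) := by
              simp only [hθ]; nlinarith
            nlinarith [hθ0 i]
      have h6 : a/(1+(i:ℝ)) ≤ 4 * a * (1/2)^k := by
        rw [div_le_iff₀ hi]
        have : (1/2:ℝ)^k * 2^k = 1 := by rw [← mul_pow]; norm_num
        have hp : (0:ℝ) < (1/2)^k := by positivity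
        have : 1 ≤ (1/2:ℝ)^k * (4*(1+i)) := by
          calc (1:ℝ) = (1/2:ℝ)^k * 2^k := this.symm
            _ ≤ _ := by gcongr
        nlinarith
      calc _ ≤ 2 * (a/(1+i)) := by linarith
        _ ≤ 8 * a * (1/2)^k := by linarith
        _ ≤ _ := by gcongr


lemma orth_norm_sum {H ι : Type*} [NormedAddCommGroup H] [InnerProductSpace ℂ H] (v : ι → H)
    (hv : Pairwise fun i j => inner ℂ (v i) (v j) = 0) (s : Finset ι) :
    ‖∑ i ∈ s, v i‖^2 = ∑ i ∈ s, ‖v i‖^2 := by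
  classical
  induction s using Finset.induction_on with
  | empty => simp
  | insert a s ha ih =>
    rw [Finset.sum_insert ha, Finset.sum_insert ha, ← ih, sq, sq, sq]
    apply norm_add_sq_eq_norm_sq_add_norm_sq_of_inner_eq_zero (𝕜 := ℂ)
    rw [inner_sum]
    apply Finset.sum_eq_zero
    intro i hi
    exact hv (fun h => ha (h ▸ hi))

lemma exists_filtration {E : Type*} [NormedAddCommGroup E] [InnerProductSpace ℂ E] [CompleteSpace E]
    [TopologicalSpace.SeparableSpace E] (R : E →L[ℂ] E) :
    ∃ F : ℕ → Submodule ℂ E, F 0 = ⊥ ∧ (∀ j, FiniteDimensional ℂ (F j)) ∧ Monotone F ∧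
      (∀ j, ∀ x ∈ F j, R x ∈ F (j+1)) ∧ (∀ j, ∀ x ∈ F j, R.adjoint x ∈ F (j+1)) ∧
      ⊤ ≤ (⨆ j, F j).topologicalClosure := by
  let d : ℕ → E := TopologicalSpace.denseSeq E
  let F : ℕ → Submodule ℂ E := fun n => Nat.rec ⊥ (fun j G => G ⊔ G.map (R : E →ₗ[ℂ] E) ⊔
    G.map (R.adjoint : E →ₗ[ℂ] E) ⊔ Submodule.span ℂ {d j}) n
  have hF : ∀ j, F (j+1) = F j ⊔ (F j).map (R : E →ₗ[ℂ] E) ⊔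
    (F j).map (R.adjoint : E →ₗ[ℂ] E) ⊔ Submodule.span ℂ {d j} := fun j => rfl
  refine ⟨F, rfl, ?_, ?_, ?_, ?_, ?_⟩
  · intro j
    induction j with
    | zero => exact (inferInstance : FiniteDimensional ℂ (⊥ : Submodule ℂ E))
    | succ j ih =>
      have key : ∀ G : Submodule ℂ E, FiniteDimensional ℂ G → FiniteDimensional ℂ
          (G ⊔ G.map (R : E →ₗ[ℂ] E) ⊔ G.map (R.adjoint : E →ₗ[ℂ] E) ⊔
            Submodule.span ℂ {d j} : Submodule ℂ E) := by
        intro G hG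
        infer_instance
      exact key _ ih
  · apply monotone_nat_of_le_succ
    intro j
    rw [hF]
    exact le_sup_left.trans (le_sup_left.trans le_sup_left)
  · intro j x hx
    rw [hF]
    exact (le_sup_right.trans (le_sup_left.trans le_sup_left) : (F j).map (R : E →ₗ[ℂ] E) ≤ _)
      (Submodule.mem_map_of_mem hx)
  · intro j x hx
    rw [hF]
    exact (le_sup_right.trans le_sup_left : (F j).map (R.adjoint : E →ₗ[ℂ] E) ≤ _)
      (Submodule.mem_map_of_mem hx)
  · intro x _
    have hd : DenseRange d := TopologicalSpace.denseRange_denseSeq E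
    apply closure_mono _ (hd x)
    rintro _ ⟨j, rfl⟩
    apply (le_iSup F (j+1))
    rw [hF]
    exact (le_sup_right : Submodule.span ℂ {d j} ≤ _) (Submodule.mem_span_singleton_self _)

/-- Abstract commutator bound for tridiagonal operators. -/
lemma comm_bound {E : Type*} [NormedAddCommGroup E] [InnerProductSpace ℂ E] [CompleteSpace E]
    (R : E →L[ℂ] E) (P : ℕ → E →L[ℂ] E) (hP0 : P 0 = 0)
    (D : ℕ → E →L[ℂ] E) (hD : ∀ j, D j = P (j+1) - P j)
    (horth : ∀ i j, i ≠ j → ∀ x y, inner ℂ (D i x) (D j y) = 0)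
    (hDn : ∀ j x, ‖D j x‖ ≤ ‖x‖)
    (hsum : ∀ n x, ∑ i ∈ Finset.range n, ‖D i x‖^2 ≤ ‖x‖^2)
    (hcomm : ∀ j, R ∘L P (j+1) - P (j+1) ∘L R = D (j+1) ∘L R ∘L D j - D j ∘L R ∘L D (j+1))
    (a : ℕ → ℝ) (δ : ℝ) (hδ : 0 ≤ δ) (ha : ∀ j, |a j| ≤ δ) (n : ℕ) :
    ‖R ∘L (∑ j ∈ Finset.range n, (a j : ℂ) • P (j+1)) - (∑ j ∈ Finset.range n, (a j : ℂ) • P (j+1)) ∘L R‖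
      ≤ 2 * δ * ‖R‖ := by
  have key1 : ∀ x, ‖∑ j ∈ Finset.range n, (a j : ℂ) • D (j+1) (R (D j x))‖ ≤ δ * ‖R‖ * ‖x‖ := by
    intro x
    apply abs_le_of_sq_le_sq' _ (by positivity) |>.2
    rw [orth_norm_sum]
    · calc _ ≤ ∑ j ∈ Finset.range n, (δ * ‖R‖)^2 * ‖D j x‖^2 := by
            apply Finset.sum_le_sum
            intro j _
            rw [← mul_pow, norm_smul]
            have : ‖D (j+1) (R (D j x))‖ ≤ ‖R‖ * ‖D j x‖ := (hDn _ _).trans (R.le_opNorm _)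
            have h2 : ‖(a j : ℂ)‖ ≤ δ := by simpa using ha j
            gcongr ?_^2
            rw [mul_assoc]
            gcongr
        _ ≤ (δ * ‖R‖)^2 * ‖x‖^2 := by
            rw [← Finset.mul_sum]; gcongr; exact hsum n x
        _ = _ := by ring
    · intro i j hij
      simp only [inner_smul_left, inner_smul_right]
      rw [horth _ _ (by omega)]; simp
  have key2 : ∀ x, ‖∑ j ∈ Finset.range n, (a j : ℂ) • D j (R (D (j+1) x))‖ ≤ δ * ‖R‖ * ‖x‖ := by
    intro x
    apply abs_le_of_sq_le_sq' _ (by positivity) |>.2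
    rw [orth_norm_sum]
    · calc _ ≤ ∑ j ∈ Finset.range n, (δ * ‖R‖)^2 * ‖D (j+1) x‖^2 := by
            apply Finset.sum_le_sum
            intro j _
            rw [← mul_pow, norm_smul]
            have : ‖D j (R (D (j+1) x))‖ ≤ ‖R‖ * ‖D (j+1) x‖ := (hDn _ _).trans (R.le_opNorm _)
            have h2 : ‖(a j : ℂ)‖ ≤ δ := by simpa using ha j
            gcongr ?_^2
            rw [mul_assoc]
            gcongr
        _ ≤ (δ * ‖R‖)^2 * ‖x‖^2 := by
            rw [← Finset.mul_sum]; gcongr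
            refine le_trans ?_ (hsum (n+1) x)
            rw [Finset.sum_range_succ']
            linarith [sq_nonneg ‖D 0 x‖]
        _ = _ := by ring
    · intro i j hij
      simp only [inner_smul_left, inner_smul_right]
      rw [horth _ _ (by omega)]; simp
  apply ContinuousLinearMap.opNorm_le_bound _ (by positivity)
  intro x
  have e : (R ∘L (∑ j ∈ Finset.range n, (a j : ℂ) • P (j+1)) - (∑ j ∈ Finset.range n, (a j : ℂ) • P (j+1)) ∘L R) x
     = ∑ j ∈ Finset.range n, (a j : ℂ) • D (j+1) (R (D j x)) - ∑ j ∈ Finset.range n, (a j : ℂ) • D j (R (D (j+1) x)) := by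
    simp only [ContinuousLinearMap.sub_apply, ContinuousLinearMap.comp_apply,
      ContinuousLinearMap.sum_apply, ContinuousLinearMap.smul_apply, map_sum, map_smul]
    rw [← Finset.sum_sub_distrib, ← Finset.sum_sub_distrib]
    apply Finset.sum_congr rfl
    intro j _
    have := congrArg (fun A => A x) (hcomm j)
    simp only [ContinuousLinearMap.sub_apply, ContinuousLinearMap.comp_apply] at this
    rw [← smul_sub, ← smul_sub, this]
  rw [e]
  calc _ ≤ _ := norm_sub_le _ _
    _ ≤ δ * ‖R‖ * ‖x‖ + δ * ‖R‖ * ‖x‖ := add_le_add (key1 x) (key2 x)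
    _ = _ := by ring

lemma exists_cutoff_ops {E : Type*} [NormedAddCommGroup E] [InnerProductSpace ℂ E] [CompleteSpace E]
    [TopologicalSpace.SeparableSpace E] (R : E →L[ℂ] E) (ε : ℝ) (hε : 0 < ε) :
    ∃ (f : ℕ → E →L[ℂ] E) (F : ℕ → Submodule ℂ E), (∀ k, FiniteDimensional ℂ (F k)) ∧
      (∀ k x, f k x ∈ F k) ∧ (∀ x, HasSum (fun k => ‖f k x‖^2) (‖x‖^2)) ∧
      (∀ k, IsSelfAdjoint (f k)) ∧
      (∀ k, ‖R ∘L f k - f k ∘L R‖ ≤ ε * (1/2)^k) ∧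
      (∀ k, ‖R.adjoint ∘L f k - f k ∘L R.adjoint‖ ≤ ε * (1/2)^k) := by
  obtain ⟨F, hF0, hFfd, hFm, hFR, hFR', hFd⟩ := exists_filtration R
  obtain ⟨φ, hφ0, hφs, hφl⟩ := exists_cutoff (ε / (2 * (‖R‖ + 1))) (by positivity)
  choose N hN using hφ0
  let P : ℕ → E →L[ℂ] E := fun j => (F j).starProjection
  let D : ℕ → E →L[ℂ] E := fun j => P (j+1) - P j
  have hP0 : P 0 = 0 := by
    have : ∀ G : Submodule ℂ E, [G.HasOrthogonalProjection] → G = ⊥ → G.starProjection = 0 := by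
      intro G _ h
      subst h
      simp
    exact this _ hF0
  have hPle : ∀ i j, i ≤ j → ∀ x, P i (P j x) = P i x := fun i j hij x => by
    have := Submodule.starProjection_comp_starProjection_of_le (hFm hij)
    exact congrArg (fun A => A x) this
  have hPmem : ∀ i x, P i x ∈ F i := fun i x => Submodule.starProjection_apply_mem _ _
  have hPfix : ∀ i x, x ∈ F i → P i x = x := fun i x hx => Submodule.starProjection_eq_self_iff.2 hx
  have hPge : ∀ i j, i ≤ j → ∀ x, P j (P i x) = P i x := fun i j hij x =>
    hPfix _ _ (hFm hij (hPmem i x))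
  have hPsym : ∀ i x y, inner ℂ (P i x) y = inner ℂ x (P i y) := fun i x y =>
    Submodule.inner_starProjection_left_eq_right _ _ _
  have hDsym : ∀ i x y, inner ℂ (D i x) y = inner ℂ x (D i y) := fun i x y => by
    simp only [D, ContinuousLinearMap.sub_apply, inner_sub_left, inner_sub_right, hPsym]
  have hDD : ∀ i j, i < j → ∀ x, D i (D j x) = 0 := fun i j hij x => by
    simp only [D, ContinuousLinearMap.sub_apply, map_sub]
    rw [hPle _ _ (by omega), hPle _ _ (by omega), hPle _ _ (by omega), hPle _ _ (by omega)]
    simp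
  have horth : ∀ i j, i ≠ j → ∀ x y, inner ℂ (D i x) (D j y) = 0 := by
    intro i j hij x y
    rcases lt_or_gt_of_ne hij with h | h
    · rw [hDsym, hDD _ _ h]; simp
    · rw [← hDsym, hDD _ _ h]; simp
  have hDsum : ∀ n x, ∑ i ∈ Finset.range n, D i x = P n x := by
    intro n x
    simp only [D, ContinuousLinearMap.sub_apply]
    rw [Finset.sum_range_sub (fun i => P i x), hP0]; simp
  have hDsq : ∀ n x, ∑ i ∈ Finset.range n, ‖D i x‖^2 = ‖P n x‖^2 := by
    intro n x
    rw [← hDsum, orth_norm_sum (fun i => D i x) (fun i j hij => horth i j hij x x)]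
  have hPn : ∀ n x, ‖P n x‖ ≤ ‖x‖ := fun n x => Submodule.norm_starProjection_apply_le _ _
  have hsum : ∀ n x, ∑ i ∈ Finset.range n, ‖D i x‖^2 ≤ ‖x‖^2 := by
    intro n x
    rw [hDsq]
    gcongr; exact hPn n x
  have hDn : ∀ j x, ‖D j x‖ ≤ ‖x‖ := by
    intro j x
    have h1 := hsum (j+1) x
    have h2 : ‖D j x‖^2 ≤ ‖x‖^2 :=
      (Finset.single_le_sum (f := fun i => ‖D i x‖^2) (fun i _ => sq_nonneg _) (Finset.self_mem_range_succ j)).trans h1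
    exact abs_le_of_sq_le_sq' h2 (norm_nonneg _) |>.2
  have htend : ∀ x, Tendsto (fun n => P n x) atTop (𝓝 x) := fun x =>
    Submodule.starProjection_tendsto_self F hFm x hFd
  have hDhas : ∀ x, HasSum (fun i => ‖D i x‖^2) (‖x‖^2) := by
    intro x
    rw [hasSum_iff_tendsto_nat_of_nonneg (fun i => sq_nonneg _)]
    simp only [hDsq]
    exact ((htend x).norm).pow 2
  have hcommG : ∀ Q : E →L[ℂ] E, (∀ j, ∀ x ∈ F j, Q x ∈ F (j+1)) → (∀ j, ∀ x ∈ F j, Q.adjoint x ∈ F (j+1)) →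
     ∀ j, Q ∘L P (j+1) - P (j+1) ∘L Q = D (j+1) ∘L Q ∘L D j - D j ∘L Q ∘L D (j+1) := by
    intro Q h1 h2 j
    have a1 : ∀ i k, i + 1 ≤ k → ∀ x, P k (Q (P i x)) = Q (P i x) := fun i k hik x =>
      hPfix _ _ (hFm hik (h1 _ _ (hPmem i x)))
    have a2 : ∀ i k, i + 1 ≤ k → ∀ x, P i (Q (P k x)) = P i (Q x) := by
      intro i k hik x
      apply ext_inner_right ℂ
      intro y
      rw [hPsym, hPsym, ← ContinuousLinearMap.adjoint_inner_right, hPsym,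
        hPfix k _ (hFm hik (h2 _ _ (hPmem i y))), ContinuousLinearMap.adjoint_inner_right]
    ext x
    simp only [D, ContinuousLinearMap.sub_apply, ContinuousLinearMap.comp_apply, map_sub]
    rw [a1 (j+1) (j+1+1) (by omega), a1 j (j+1+1) (by omega), a1 j (j+1) (by omega),
      a2 (j+1) (j+1+1) (by omega), a2 j (j+1+1) (by omega), a2 j (j+1) (by omega)]
    abel
  let f : ℕ → E →L[ℂ] E := fun k => ∑ j ∈ Finset.range (N k), (φ k j : ℂ) • D j
  have abel' : ∀ k n, ∑ j ∈ Finset.range n, (φ k j : ℂ) • D j =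
      ∑ j ∈ Finset.range n, ((φ k j - φ k (j+1) : ℝ) : ℂ) • P (j+1) + (φ k n : ℂ) • P n := by
    intro k n
    induction n with
    | zero => simp [hP0]
    | succ n ih =>
      rw [Finset.sum_range_succ, Finset.sum_range_succ, ih]
      simp only [D, Complex.ofReal_sub]
      module
  have hf : ∀ k, f k = ∑ j ∈ Finset.range (N k), ((φ k j - φ k (j+1) : ℝ) : ℂ) • P (j+1) := by
    intro k
    simp only [f]
    rw [abel', hN k _ le_rfl]; simp
  have hfsq : ∀ k x, HasSum (fun i => φ k i ^2 * ‖D i x‖^2) (‖f k x‖^2) := by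
    intro k x
    have : ‖f k x‖^2 = ∑ i ∈ Finset.range (N k), φ k i ^2 * ‖D i x‖^2 := by
      simp only [f, ContinuousLinearMap.sum_apply, ContinuousLinearMap.smul_apply]
      rw [orth_norm_sum]
      · apply Finset.sum_congr rfl
        intro i _
        rw [norm_smul, mul_pow]; simp
      · intro i j hij
        simp only [inner_smul_left, inner_smul_right]
        rw [horth _ _ hij]; simp
    rw [this]
    apply hasSum_sum_of_ne_finset_zero
    intro i hi
    rw [hN k i (by simpa using hi)]; simp
  refine ⟨f, fun k => F (N k), fun k => hFfd _, ?_, ?_, ?_, ?_, ?_⟩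
  · intro k x
    rw [hf]
    simp only [ContinuousLinearMap.sum_apply, ContinuousLinearMap.smul_apply]
    apply Submodule.sum_mem
    intro j hj
    apply Submodule.smul_mem
    exact hFm (by simpa using hj) (hPmem _ _)
  · intro x
    have s1 : ∀ i, HasSum (fun k => φ k i ^2 * ‖D i x‖^2) (‖D i x‖^2) := fun i => by
      simpa using (hφs i).mul_right (‖D i x‖^2)
    have s2 : Summable (fun p : ℕ × ℕ => φ p.2 p.1 ^2 * ‖D p.1 x‖^2) := by
      rw [summable_prod_of_nonneg (fun p => by positivity)]
      refine ⟨fun i => (s1 i).summable, ?_⟩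
      simp only [(s1 _).tsum_eq]
      exact (hDhas x).summable
    have s3 : HasSum (fun p : ℕ × ℕ => φ p.2 p.1 ^2 * ‖D p.1 x‖^2) (‖x‖^2) := by
      have := s2.hasSum.prod_fiberwise s1
      rw [← this.unique (hDhas x)]
      exact s2.hasSum
    have s4 : HasSum (fun p : ℕ × ℕ => φ p.1 p.2 ^2 * ‖D p.2 x‖^2) (‖x‖^2) :=
      ((Equiv.prodComm ℕ ℕ).hasSum_iff (f := fun p : ℕ × ℕ => φ p.2 p.1 ^2 * ‖D p.1 x‖^2)).2 s3
    exact s4.prod_fiberwise (fun k => hfsq k x)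
  · intro k
    rw [ContinuousLinearMap.isSelfAdjoint_iff_isSymmetric]
    intro x y
    simp only [f, ContinuousLinearMap.coe_coe, ContinuousLinearMap.sum_apply, ContinuousLinearMap.smul_apply,
      sum_inner, inner_sum, inner_smul_left, inner_smul_right, hDsym, Complex.conj_ofReal]
  · intro k
    rw [hf]
    have := comm_bound R P hP0 D (fun j => rfl) horth hDn hsum (hcommG R hFR hFR')
      (fun j => φ k j - φ k (j+1)) (ε / (2 * (‖R‖ + 1)) * (1/2)^k) (by positivity) (hφl k) (N k)
    refine this.trans ?_
    have e : 2 * (ε / (2 * (‖R‖ + 1)) * (1/2)^k) * ‖R‖ = ε * (1/2)^k * (‖R‖/(‖R‖+1)) := by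
      field_simp
    rw [e]
    apply mul_le_of_le_one_right (by positivity)
    rw [div_le_one (by positivity)]; linarith
  · intro k
    rw [hf]
    have := comm_bound R.adjoint P hP0 D (fun j => rfl) horth hDn hsum
      (hcommG R.adjoint hFR' (by simpa using hFR))
      (fun j => φ k j - φ k (j+1)) (ε / (2 * (‖R‖ + 1)) * (1/2)^k) (by positivity) (hφl k) (N k)
    refine this.trans ?_
    rw [LinearIsometryEquiv.norm_map]
    have e : 2 * (ε / (2 * (‖R‖ + 1)) * (1/2)^k) * ‖R‖ = ε * (1/2)^k * (‖R‖/(‖R‖+1)) := by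
      field_simp
    rw [e]
    apply mul_le_of_le_one_right (by positivity)
    rw [div_le_one (by positivity)]; linarith



/-- An operator that is compact together with its adjoint. -/
def BiC {X Y : Type*} [NormedAddCommGroup X] [InnerProductSpace ℂ X] [CompleteSpace X]
    [NormedAddCommGroup Y] [InnerProductSpace ℂ Y] [CompleteSpace Y] (K : X →L[ℂ] Y) : Prop :=
  IsCompactOperator K ∧ IsCompactOperator (ContinuousLinearMap.adjoint K)

section BiCLemmas
variable {X Y Z : Type*} [NormedAddCommGroup X] [InnerProductSpace ℂ X] [CompleteSpace X]
    [NormedAddCommGroup Y] [InnerProductSpace ℂ Y] [CompleteSpace Y]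
    [NormedAddCommGroup Z] [InnerProductSpace ℂ Z] [CompleteSpace Z]

lemma BiC.add' {K L : X →L[ℂ] Y} (hK : BiC K) (hL : BiC L) : BiC (K + L) :=
  ⟨hK.1.add hL.1, by rw [map_add]; exact hK.2.add hL.2⟩

lemma BiC.sub' {K L : X →L[ℂ] Y} (hK : BiC K) (hL : BiC L) : BiC (K - L) :=
  ⟨hK.1.sub hL.1, by rw [map_sub]; exact hK.2.sub hL.2⟩

lemma BiC.zero' : BiC (0 : X →L[ℂ] Y) :=
  ⟨isCompactOperator_zero, by rw [map_zero]; exact isCompactOperator_zero⟩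

lemma BiC.adj {K : X →L[ℂ] Y} (hK : BiC K) : BiC (ContinuousLinearMap.adjoint K) :=
  ⟨hK.2, by rw [ContinuousLinearMap.adjoint_adjoint]; exact hK.1⟩

lemma BiC.left {K : X →L[ℂ] Y} (hK : BiC K) (A : Y →L[ℂ] Z) : BiC (A ∘L K) :=
  ⟨hK.1.clm_comp A, by rw [ContinuousLinearMap.adjoint_comp]; exact hK.2.comp_clm _⟩

lemma BiC.right {K : Y →L[ℂ] Z} (hK : BiC K) (A : X →L[ℂ] Y) : BiC (K ∘L A) :=
  ⟨hK.1.comp_clm A, by rw [ContinuousLinearMap.adjoint_comp]; exact hK.2.clm_comp (ContinuousLinearMap.adjoint A)⟩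

lemma BiC.sum' {ι : Type*} (s : Finset ι) (K : ι → X →L[ℂ] Y) (hK : ∀ i, BiC (K i)) :
    BiC (∑ i ∈ s, K i) := by
  classical
  induction s using Finset.induction_on with
  | empty => simpa using BiC.zero'
  | insert a s ha ih => rw [Finset.sum_insert ha]; exact (hK a).add' ih

lemma BiC.hasSum {ι : Type*} (K : ι → X →L[ℂ] Y) (hK : ∀ i, BiC (K i)) (L : X →L[ℂ] Y)
    (h : HasSum K L) : BiC L := by
  constructor
  · exact isCompactOperator_of_tendsto h (Filter.Eventually.of_forall fun s => (BiC.sum' s K hK).1)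
  · have h2 : Tendsto (fun s : Finset ι => ContinuousLinearMap.adjoint (∑ i ∈ s, K i)) atTop
        (𝓝 (ContinuousLinearMap.adjoint L)) :=
      ((ContinuousLinearMap.adjoint (𝕜 := ℂ) (E := X) (F := Y)).continuous.tendsto L).comp h
    exact isCompactOperator_of_tendsto h2 (Filter.Eventually.of_forall fun s => (BiC.sum' s K hK).2)

lemma BiC.of_range_le (K : X →L[ℂ] Y) (G : Submodule ℂ Y) [FiniteDimensional ℂ G] (h : ∀ x, K x ∈ G) :
    BiC K := by
  have hP : IsCompactOperator (G.starProjection) := by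
    have h1 : IsCompactOperator (G.subtypeL) :=
      (isCompactOperator_id (E := G)).clm_comp G.subtypeL
    exact h1.comp_clm (G.orthogonalProjectionOnto)
  have e : K = G.starProjection ∘L K := by
    ext x
    simp [Submodule.starProjection_eq_self_iff.2 (h x)]
  have e2 : ContinuousLinearMap.adjoint K = ContinuousLinearMap.adjoint K ∘L G.starProjection := by
    conv_lhs => rw [e]
    rw [ContinuousLinearMap.adjoint_comp]
    congr 1
    exact (isSelfAdjoint_starProjection G).adjoint_eq
  refine ⟨?_, ?_⟩
  · rw [e]; exact hP.comp_clm K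
  · rw [e2]; exact hP.clm_comp (ContinuousLinearMap.adjoint K)

end BiCLemmas

lemma orth_hasSum {H : Type*} [NormedAddCommGroup H] [InnerProductSpace ℂ H] [CompleteSpace H]
    (v : ℕ → H) (hv : Pairwise fun i j => inner ℂ (v i) (v j) = 0) (s : ℝ)
    (hs : HasSum (fun k => ‖v k‖^2) s) : ∃ y, HasSum v y ∧ ‖y‖^2 = s := by
  have hO : OrthogonalFamily ℂ (fun i => Submodule.span ℂ {v i}) (fun i => (Submodule.span ℂ {v i}).subtypeₗᵢ) := by
    intro i j hij a b
    obtain ⟨c, hc⟩ := Submodule.mem_span_singleton.1 a.2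
    obtain ⟨d, hd⟩ := Submodule.mem_span_singleton.1 b.2
    show inner ℂ (a : H) (b : H) = 0
    rw [← hc, ← hd, inner_smul_left, inner_smul_right, hv hij]
    simp
  have h1 := (hO.summable_iff_norm_sq_summable
    (fun i => ⟨v i, Submodule.mem_span_singleton_self _⟩)).2 (by simpa using hs.summable)
  have h2 : Summable v := by simpa using h1
  refine ⟨_, h2.hasSum, ?_⟩
  have t1 : Tendsto (fun s : Finset ℕ => ‖∑ i ∈ s, v i‖^2) atTop (𝓝 (‖∑' i, v i‖^2)) :=
    (h2.hasSum.norm).pow 2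
  simp only [orth_norm_sum v hv] at t1
  exact tendsto_nhds_unique t1 hs

lemma exists_isometry_of_orth {E H : Type*} [NormedAddCommGroup H] [InnerProductSpace ℂ H] [CompleteSpace H]
    [NormedAddCommGroup E] [InnerProductSpace ℂ E] (B : ℕ → E →L[ℂ] H)
    (hB : ∀ i j, i ≠ j → ∀ x y, inner ℂ (B i x) (B j y) = 0)
    (hs : ∀ x, HasSum (fun k => ‖B k x‖^2) (‖x‖^2)) :
    ∃ V : E →ₗᵢ[ℂ] H, ∀ x, HasSum (fun k => B k x) (V x) := by
  have h := fun x => orth_hasSum (fun k => B k x) (fun i j hij => hB i j hij x x) _ (hs x)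
  choose V hV hVn using h
  refine ⟨{ toFun := V, map_add' := ?_, map_smul' := ?_, norm_map' := ?_ }, hV⟩
  · intro x y
    refine (hV (x+y)).unique ?_
    simpa using (hV x).add (hV y)
  · intro c x
    refine (hV (c • x)).unique ?_
    simpa using (hV x).const_smul c
  · intro x
    have := hVn x
    exact (sq_eq_sq₀ (norm_nonneg _) (norm_nonneg _)).1 this

/-- `R` is locally approximable by `T` away from finite-dimensional subspaces. -/
def OpAbsorbs {E H : Type*} [NormedAddCommGroup H] [InnerProductSpace ℂ H] [CompleteSpace H]
    [NormedAddCommGroup E] [InnerProductSpace ℂ E] [CompleteSpace E]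
    (T : H →L[ℂ] H) (R : E →L[ℂ] E) : Prop :=
  ∀ (F : Submodule ℂ E) (G : Submodule ℂ H), FiniteDimensional ℂ F → FiniteDimensional ℂ G →
    ∀ ε : ℝ, 0 < ε → ∃ A : E →L[ℂ] H, ‖A‖ ≤ 1 ∧ (∀ x ∈ F, ‖A x‖ = ‖x‖) ∧
      (∃ G' : Submodule ℂ H, FiniteDimensional ℂ G' ∧ ∀ x, A x ∈ G') ∧
      (∀ x, ∀ g ∈ G, inner ℂ g (A x) = 0) ∧
      (∀ x ∈ F, ‖T (A x) - A (R x)‖ ≤ ε * ‖x‖) ∧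
      (∀ x ∈ F, ‖T.adjoint (A x) - A (R.adjoint x)‖ ≤ ε * ‖x‖)

lemma OpAbsorbs.seq {E H : Type*} [NormedAddCommGroup H] [InnerProductSpace ℂ H] [CompleteSpace H]
    [NormedAddCommGroup E] [InnerProductSpace ℂ E] [CompleteSpace E]
    {T : H →L[ℂ] H} {R : E →L[ℂ] E} (h : OpAbsorbs T R) (F : ℕ → Submodule ℂ E)
    (hF : ∀ n, FiniteDimensional ℂ (F n)) (ε : ℕ → ℝ) (hε : ∀ n, 0 < ε n) :
    ∃ A : ℕ → E →L[ℂ] H, (∀ n, ‖A n‖ ≤ 1) ∧ (∀ n, ∀ x ∈ F n, ‖A n x‖ = ‖x‖) ∧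
      (∀ n, ∃ G' : Submodule ℂ H, FiniteDimensional ℂ G' ∧ ∀ x, A n x ∈ G') ∧
      (∀ m n, m ≠ n → ∀ x y, inner ℂ (A m x) (A n y) = 0) ∧
      (∀ n, ∀ x ∈ F n, ‖T (A n x) - A n (R x)‖ ≤ ε n * ‖x‖) ∧
      (∀ n, ∀ x ∈ F n, ‖T.adjoint (A n x) - A n (R.adjoint x)‖ ≤ ε n * ‖x‖) := by
  unfold OpAbsorbs at h
  have h' := fun (n : ℕ) (G : {G : Submodule ℂ H // FiniteDimensional ℂ G}) =>
    h (F n) G.1 (hF n) G.2 (ε n) (hε n)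
  choose A' a1 a2 a34 a5 a6 a7 using h'
  choose G' a3 a4 using a34
  let G : ℕ → {G : Submodule ℂ H // FiniteDimensional ℂ G} := fun n =>
    Nat.rec ⟨⊥, inferInstance⟩ (fun n g => ⟨g.1 ⊔ G' n g, by
      haveI := g.2; haveI := a3 n g; infer_instance⟩) n
  have hG : ∀ n, (G (n+1)).1 = (G n).1 ⊔ G' n (G n) := fun n => rfl
  have hGm : Monotone (fun n => (G n).1) := monotone_nat_of_le_succ (fun n => by rw [hG]; exact le_sup_left)
  have hmem : ∀ m n, m < n → ∀ x, A' m (G m) x ∈ (G n).1 := by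
    intro m n hmn x
    apply hGm (show m+1 ≤ n from hmn)
    show _ ∈ (G (m+1)).1
    rw [hG]
    exact (le_sup_right : G' m (G m) ≤ _) (a4 m (G m) x)
  refine ⟨fun n => A' n (G n), fun n => a1 n _, fun n => a2 n _, fun n => ⟨_, a3 n (G n), a4 n (G n)⟩, ?_,
    fun n => a6 n _, fun n => a7 n _⟩
  intro m n hmn x y
  rcases lt_or_gt_of_ne hmn with hl | hl
  · exact a5 n (G n) y _ (hmem m n hl x)
  · rw [inner_eq_zero_symm]
    exact a5 m (G m) x _ (hmem n m hl y)

lemma OpAbsorbs.defect {E H : Type*} [NormedAddCommGroup H] [InnerProductSpace ℂ H] [CompleteSpace H]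
    [NormedAddCommGroup E] [InnerProductSpace ℂ E] [CompleteSpace E]
    (T : H →L[ℂ] H) (R : E →L[ℂ] E) (V : E →ₗᵢ[ℂ] H) (A : ℕ → E →L[ℂ] H) (f : ℕ → E →L[ℂ] E)
    (F : ℕ → Submodule ℂ E) (hF : ∀ k, FiniteDimensional ℂ (F k))
    (hf : ∀ k x, f k x ∈ F k) (hfn : ∀ k x, ‖f k x‖ ≤ ‖x‖)
    (hV : ∀ x, HasSum (fun k => A k (f k x)) (V x)) (η : ℝ) (hη : 0 ≤ η)
    (hA : ∀ k, ‖A k‖ ≤ 1)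
    (hAf : ∀ k, ∃ G' : Submodule ℂ H, FiniteDimensional ℂ G' ∧ ∀ x, A k x ∈ G')
    (h1 : ∀ k, ∀ x ∈ F k, ‖T (A k x) - A k (R x)‖ ≤ η * (1/2)^k * ‖x‖)
    (h2 : ∀ k, ‖R ∘L f k - f k ∘L R‖ ≤ η * (1/2)^k) :
    BiC (T ∘L V.toContinuousLinearMap - V.toContinuousLinearMap ∘L R) ∧
      ‖T ∘L V.toContinuousLinearMap - V.toContinuousLinearMap ∘L R‖ ≤ 4 * η := by
  let C : ℕ → E →L[ℂ] H := fun k => T ∘L A k ∘L f k - A k ∘L f k ∘L R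
  have hCn : ∀ k, ‖C k‖ ≤ 2 * η * (1/2)^k := by
    intro k
    apply ContinuousLinearMap.opNorm_le_bound _ (by positivity)
    intro x
    have e : C k x = (T (A k (f k x)) - A k (R (f k x))) + A k ((R ∘L f k - f k ∘L R) x) := by
      simp only [C, ContinuousLinearMap.sub_apply, ContinuousLinearMap.comp_apply, map_sub]
      abel
    rw [e]
    have b1 := h1 k _ (hf k x)
    have b2 : ‖A k ((R ∘L f k - f k ∘L R) x)‖ ≤ η * (1/2)^k * ‖x‖ := by
      calc _ ≤ ‖A k‖ * ‖(R ∘L f k - f k ∘L R) x‖ := (A k).le_opNorm _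
        _ ≤ 1 * (η * (1/2)^k * ‖x‖) := by
          gcongr
          · exact hA k
          · exact (ContinuousLinearMap.le_opNorm _ _).trans (by gcongr; exact h2 k)
        _ = _ := by ring
    have b3 : η * (1/2)^k * ‖f k x‖ ≤ η * (1/2)^k * ‖x‖ := by
      gcongr; exact hfn k x
    calc _ ≤ _ := norm_add_le _ _
      _ ≤ η * (1/2)^k * ‖x‖ + η * (1/2)^k * ‖x‖ := add_le_add (b1.trans b3) b2
      _ = _ := by ring
  have hgeo : HasSum (fun k : ℕ => 2 * η * (1/2 : ℝ)^k) (4 * η) := by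
    have := (hasSum_geometric_two).mul_left (2 * η)
    rwa [show 2 * η * 2 = 4 * η by ring] at this
  have hsum : Summable C := Summable.of_norm_bounded hgeo.summable hCn
  have heq : ∑' k, C k = T ∘L V.toContinuousLinearMap - V.toContinuousLinearMap ∘L R := by
    ext x
    have s1 : HasSum (fun k => C k x) ((∑' k, C k) x) :=
      hsum.hasSum.mapL (ContinuousLinearMap.apply ℂ H x)
    have s2 : HasSum (fun k => C k x) (T (V x) - V (R x)) := by
      have a1 : HasSum (fun k => T (A k (f k x))) (T (V x)) := (hV x).mapL T
      have a2 : HasSum (fun k => T (A k (f k x)) - A k (f k (R x))) (T (V x) - V (R x)) := a1.sub (hV (R x))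
      have a3 : (fun k => C k x) = (fun k => T (A k (f k x)) - A k (f k (R x))) := by
        funext k
        simp only [C, ContinuousLinearMap.sub_apply, ContinuousLinearMap.comp_apply]
      rw [a3]; exact a2
    exact s1.unique s2
  rw [← heq]
  constructor
  · apply BiC.hasSum C _ _ hsum.hasSum
    intro k
    obtain ⟨G', hG', hm⟩ := hAf k
    have hAk : BiC (A k) := BiC.of_range_le (A k) G' hm
    exact ((hAk.right (f k)).left T).sub' (hAk.right (f k ∘L R))
  · exact tsum_of_norm_bounded hgeo hCn

lemma OpAbsorbs.isometries {E H : Type*} [NormedAddCommGroup H] [InnerProductSpace ℂ H] [CompleteSpace H]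
    [NormedAddCommGroup E] [InnerProductSpace ℂ E] [CompleteSpace E] [TopologicalSpace.SeparableSpace E]
    {T : H →L[ℂ] H} {R : E →L[ℂ] E} (h : OpAbsorbs T R) (ε : ℝ) (hε : 0 < ε) :
    ∃ V : ℕ → E →ₗᵢ[ℂ] H, (∀ i j, i ≠ j → ∀ x y, inner ℂ (V i x) (V j y) = 0) ∧
      (∀ j, BiC (T ∘L (V j).toContinuousLinearMap - (V j).toContinuousLinearMap ∘L R)) ∧
      (∀ j, ‖T ∘L (V j).toContinuousLinearMap - (V j).toContinuousLinearMap ∘L R‖ ≤ ε * (1/2)^j) ∧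
      (∀ j, BiC (T.adjoint ∘L (V j).toContinuousLinearMap - (V j).toContinuousLinearMap ∘L R.adjoint)) ∧
      (∀ j, ‖T.adjoint ∘L (V j).toContinuousLinearMap - (V j).toContinuousLinearMap ∘L R.adjoint‖ ≤ ε * (1/2)^j) := by
  have hc := fun j : ℕ => exists_cutoff_ops R (ε * (1/2)^j/4) (by positivity)
  choose f F hF hf hfs hfsa hf1 hf2 using hc
  obtain ⟨A, hA1, hA2, hA3, hA4, hA5, hA6⟩ := h.seq (fun n => F n.unpair.1 n.unpair.2) (fun n => hF _ _)
    (fun n => ε * (1/2)^(n.unpair.1)/4 * (1/2)^(n.unpair.2)) (fun n => by positivity)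
  have hfn : ∀ j k x, ‖f j k x‖ ≤ ‖x‖ := by
    intro j k x
    have : ‖f j k x‖^2 ≤ ‖x‖^2 := le_hasSum (hfs j x) k (fun i _ => sq_nonneg _)
    exact abs_le_of_sq_le_sq' this (norm_nonneg _) |>.2
  have hiso : ∀ j, ∃ V : E →ₗᵢ[ℂ] H, ∀ x, HasSum (fun k => A (Nat.pair j k) (f j k x)) (V x) := by
    intro j
    refine exists_isometry_of_orth (fun k => A (Nat.pair j k) ∘L f j k) ?_ ?_
    · intro k l hkl x y
      apply hA4
      intro e
      exact hkl (Nat.pair_eq_pair.1 e).2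
    · intro x
      have : ∀ k, ‖(A (Nat.pair j k) ∘L f j k) x‖^2 = ‖f j k x‖^2 := by
        intro k
        have := hA2 (Nat.pair j k) (f j k x) (by simpa using hf j k x)
        rw [ContinuousLinearMap.comp_apply, this]
      simp only [this]
      exact hfs j x
  choose V hV using hiso
  have d1 := fun j => OpAbsorbs.defect T R (V j) (fun k => A (Nat.pair j k)) (f j) (F j) (hF j) (hf j) (hfn j)
    (hV j) (ε * (1/2)^j/4) (by positivity) (fun k => hA1 _) (fun k => hA3 _)
    (fun k x hx => by simpa using hA5 (Nat.pair j k) x (by simpa using hx)) (hf1 j)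
  have d2 := fun j => OpAbsorbs.defect T.adjoint R.adjoint (V j) (fun k => A (Nat.pair j k)) (f j) (F j) (hF j) (hf j) (hfn j)
    (hV j) (ε * (1/2)^j/4) (by positivity) (fun k => hA1 _) (fun k => hA3 _)
    (fun k x hx => by simpa using hA6 (Nat.pair j k) x (by simpa using hx)) (hf2 j)
  refine ⟨V, ?_, fun j => (d1 j).1, fun j => (d1 j).2.trans (by linarith), fun j => (d2 j).1,
    fun j => (d2 j).2.trans (by linarith)⟩
  intro i j hij x y
  have hz : ∀ k, inner ℂ (A (Nat.pair i k) (f i k x)) (V j y) = 0 := by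
    intro k
    have s1 := (innerSL ℂ (A (Nat.pair i k) (f i k x))).hasSum (hV j y)
    refine s1.unique ?_
    have : ∀ l, (innerSL ℂ (A (Nat.pair i k) (f i k x))) (A (Nat.pair j l) (f j l y)) = 0 := by
      intro l
      rw [innerSL_apply_apply]
      apply hA4
      intro e
      exact hij (Nat.pair_eq_pair.1 e).1
    simp only [this]
    exact hasSum_zero
  rw [inner_eq_zero_symm]
  have s1 := (innerSL ℂ (V j y)).hasSum (hV i x)
  refine s1.unique ?_
  have : ∀ l, (innerSL ℂ (V j y)) (A (Nat.pair i l) (f i l x)) = 0 := by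
    intro l
    rw [innerSL_apply_apply, inner_eq_zero_symm]
    exact hz l
  simp only [this]
  exact hasSum_zero


section Absorption
local notation "adj" => ContinuousLinearMap.adjoint

lemma equiv_of_adj {M H : Type*} [NormedAddCommGroup H] [InnerProductSpace ℂ H] [CompleteSpace H]
    [NormedAddCommGroup M] [InnerProductSpace ℂ M] [CompleteSpace M] (W : M →L[ℂ] H)
    (h1 : ∀ m, adj W (W m) = m) (h2 : ∀ y, W (adj W y) = y) :
    ∃ U : M ≃ₗᵢ[ℂ] H, ∀ m, U m = W m := by
  refine ⟨⟨LinearEquiv.ofLinear (W : M →ₗ[ℂ] H) (adj W : H →ₗ[ℂ] M) ?_ ?_, ?_⟩, ?_⟩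
  · ext y; exact h2 y
  · ext y; exact h1 y
  · intro m
    show ‖W m‖ = ‖m‖
    have : inner ℂ (W m) (W m) = inner ℂ m m := by
      rw [← ContinuousLinearMap.adjoint_inner_right, h1]
    rw [inner_self_eq_norm_sq_to_K, inner_self_eq_norm_sq_to_K] at this
    have h3 : ‖W m‖^2 = ‖m‖^2 := by exact_mod_cast this
    exact (sq_eq_sq₀ (norm_nonneg _) (norm_nonneg _)).1 h3
  · intro m; rfl

lemma isom_adj_apply {M H : Type*} [NormedAddCommGroup H] [InnerProductSpace ℂ H] [CompleteSpace H]
    [NormedAddCommGroup M] [InnerProductSpace ℂ M] [CompleteSpace M] (V : M →ₗᵢ[ℂ] H) (m : M) :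
    adj V.toContinuousLinearMap (V m) = m := by
  apply ext_inner_left ℂ
  intro v
  rw [ContinuousLinearMap.adjoint_inner_right]
  exact V.inner_map_map v m

lemma unitary_alg {L E H M : Type*} [NormedAddCommGroup H] [InnerProductSpace ℂ H] [CompleteSpace H]
    [NormedAddCommGroup E] [InnerProductSpace ℂ E] [CompleteSpace E]
    [NormedAddCommGroup L] [InnerProductSpace ℂ L] [CompleteSpace L]
    [NormedAddCommGroup M] [InnerProductSpace ℂ M] [CompleteSpace M]
    (ι : H →ₗᵢ[ℂ] M) (κ : E →ₗᵢ[ℂ] M) (hικ : ∀ h e, inner ℂ (ι h) (κ e) = 0)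
    (hdec : ∀ m, ι (adj ι.toContinuousLinearMap m) + κ (adj κ.toContinuousLinearMap m) = m)
    (V Vp : L →ₗᵢ[ℂ] H) (V0 : E →ₗᵢ[ℂ] H) (h0 : ∀ x e, inner ℂ (Vp x) (V0 e) = 0)
    (hV : ∀ y, V (adj V.toContinuousLinearMap y) =
      Vp (adj Vp.toContinuousLinearMap y) + V0 (adj V0.toContinuousLinearMap y)) :
    ∃ U : M ≃ₗᵢ[ℂ] H, ∀ m, U m = adj ι.toContinuousLinearMap m
      - V (adj V.toContinuousLinearMap (adj ι.toContinuousLinearMap m))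
      + Vp (adj V.toContinuousLinearMap (adj ι.toContinuousLinearMap m))
      + V0 (adj κ.toContinuousLinearMap m) := by
  set i := ι.toContinuousLinearMap
  set k := κ.toContinuousLinearMap
  set v := V.toContinuousLinearMap
  set p := Vp.toContinuousLinearMap
  set z := V0.toContinuousLinearMap
  have ai : ∀ x, adj i (i x) = x := fun x => isom_adj_apply ι x
  have ak : ∀ x, adj k (k x) = x := fun x => isom_adj_apply κ x
  have av : ∀ x, adj v (v x) = x := fun x => isom_adj_apply V x
  have ap : ∀ x, adj p (p x) = x := fun x => isom_adj_apply Vp x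
  have az : ∀ x, adj z (z x) = x := fun x => isom_adj_apply V0 x
  have aik : ∀ x, adj i (k x) = 0 := by
    intro x
    apply ext_inner_left ℂ; intro y
    rw [ContinuousLinearMap.adjoint_inner_right, inner_zero_right]; exact hικ y x
  have aki : ∀ x, adj k (i x) = 0 := by
    intro x
    apply ext_inner_left ℂ; intro y
    rw [ContinuousLinearMap.adjoint_inner_right, inner_zero_right, inner_eq_zero_symm]; exact hικ x y
  have apz : ∀ x, adj p (z x) = 0 := by
    intro x
    apply ext_inner_left ℂ; intro y
    rw [ContinuousLinearMap.adjoint_inner_right, inner_zero_right]; exact h0 y x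
  have azp : ∀ x, adj z (p x) = 0 := by
    intro x
    apply ext_inner_left ℂ; intro y
    rw [ContinuousLinearMap.adjoint_inner_right, inner_zero_right, inner_eq_zero_symm]; exact h0 x y
  have hdec' : ∀ m, i (adj i m) + k (adj k m) = m := hdec
  have hV' : ∀ y, v (adj v y) = p (adj p y) + z (adj z y) := hV
  have hvv : ∀ y, adj v (p (adj p y)) + adj v (z (adj z y)) = adj v y := by
    intro y; rw [← map_add, ← hV', av]
  let W : M →L[ℂ] H := adj i - v ∘L adj v ∘L adj i + p ∘L adj v ∘L adj i + z ∘L adj k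
  have hW : ∀ m, W m = adj i m - v (adj v (adj i m)) + p (adj v (adj i m)) + z (adj k m) := fun m => rfl
  have hW' : ∀ y, adj W y = i y - i (v (adj v y)) + i (v (adj p y)) + k (adj z y) := by
    intro y
    apply ext_inner_left ℂ
    intro m
    rw [ContinuousLinearMap.adjoint_inner_right, hW]
    simp only [inner_add_left, inner_add_right, inner_sub_left, inner_sub_right,
      ← ContinuousLinearMap.adjoint_inner_left, ContinuousLinearMap.adjoint_adjoint]
  obtain ⟨U, hU⟩ := equiv_of_adj W (by
    intro m
    rw [hW', hW]
    simp only [hV', map_add, map_sub, ap, az, apz, azp, av, add_zero, zero_add, sub_zero, map_zero]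
    conv_rhs => rw [← hdec' m]
    abel) (by
    intro y
    rw [hW, hW']
    simp only [map_add, map_sub, ai, ak, aik, aki, av, add_zero, zero_add, sub_zero, map_zero]
    simp only [hV', map_add, map_sub, ap, az, apz, azp, av, add_zero, zero_add, sub_zero, map_zero]
    have := congrArg p (hvv y)
    rw [map_add] at this
    rw [← this]
    abel)
  exact ⟨U, fun m => by rw [hU, hW]; rfl⟩

lemma orth_family_data {E H : Type*} [NormedAddCommGroup H] [InnerProductSpace ℂ H] [CompleteSpace H]
    [NormedAddCommGroup E] [InnerProductSpace ℂ E] [CompleteSpace E]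
    (V : ℕ → E →ₗᵢ[ℂ] H) (hV : ∀ i j, i ≠ j → ∀ x y, inner ℂ (V i x) (V j y) = 0) :
    ∃ Vt : lp (fun _ : ℕ => E) 2 →ₗᵢ[ℂ] H,
      (∀ f : lp (fun _ : ℕ => E) 2, HasSum (fun j => V j (f j)) (Vt f)) ∧
      (∀ h j, (adj Vt.toContinuousLinearMap h : lp (fun _ : ℕ => E) 2) j
        = adj (V j).toContinuousLinearMap h) := by
  have hO : OrthogonalFamily ℂ (fun _ : ℕ => E) V := fun i j hij x y => hV i j hij x y
  refine ⟨hO.linearIsometry, hO.hasSum_linearIsometry, ?_⟩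
  intro h j
  apply ext_inner_left ℂ
  intro e
  have a1 := lp.inner_single_left (𝕜 := ℂ) j e (adj hO.linearIsometry.toContinuousLinearMap h)
  refine a1.symm.trans ?_
  rw [ContinuousLinearMap.adjoint_inner_right, ContinuousLinearMap.adjoint_inner_right]
  congr 1
  exact hO.linearIsometry_apply_single e

lemma absorb_unitary {E H M : Type*} [NormedAddCommGroup H] [InnerProductSpace ℂ H] [CompleteSpace H]
    [NormedAddCommGroup E] [InnerProductSpace ℂ E] [CompleteSpace E] [TopologicalSpace.SeparableSpace E]
    [NormedAddCommGroup M] [InnerProductSpace ℂ M] [CompleteSpace M]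
    (ι : H →ₗᵢ[ℂ] M) (κ : E →ₗᵢ[ℂ] M) (hικ : ∀ h e, inner ℂ (ι h) (κ e) = 0)
    (hdec : ∀ m, ι (adj ι.toContinuousLinearMap m) + κ (adj κ.toContinuousLinearMap m) = m)
    (T : H →L[ℂ] H) (R : E →L[ℂ] E) (That : M →L[ℂ] M)
    (hTι : ∀ h, That (ι h) = ι (T h)) (hTκ : ∀ e, That (κ e) = κ (R e))
    (hA : OpAbsorbs T R) (ε : ℝ) (hε : 0 < ε) :
    ∃ U : M ≃ₗᵢ[ℂ] H,
      IsCompactOperator (T ∘L (U.toContinuousLinearEquiv : M →L[ℂ] H) -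
        (U.toContinuousLinearEquiv : M →L[ℂ] H) ∘L That) ∧
      ‖T ∘L (U.toContinuousLinearEquiv : M →L[ℂ] H) -
        (U.toContinuousLinearEquiv : M →L[ℂ] H) ∘L That‖ ≤ 9 * ε := by
  obtain ⟨V, hV, hk, hkn, hk', hkn'⟩ := hA.isometries ε hε
  obtain ⟨Vt, hVt1, hVt2⟩ := orth_family_data V hV
  obtain ⟨Vp, hVp1, hVp2⟩ := orth_family_data (fun j => V (j+1)) (fun i j hij => hV _ _ (by omega))
  obtain ⟨U, hU⟩ := unitary_alg ι κ hικ hdec Vt Vp (V 0) (by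
      intro x e
      rw [inner_eq_zero_symm]
      have s1 := (hVp1 x).mapL (innerSL ℂ (V 0 e))
      refine s1.unique ?_
      have : ∀ l, (innerSL ℂ (V 0 e)) (V (l+1) (x l)) = 0 := by
        intro l
        rw [innerSL_apply_apply]
        exact hV _ _ (by omega) _ _
      simp only [this]
      exact hasSum_zero) (by
      intro y
      have s1 := hVt1 (adj Vt.toContinuousLinearMap y)
      have s2 := hVp1 (adj Vp.toContinuousLinearMap y)
      simp only [hVt2] at s1
      simp only [hVp2] at s2
      have s3 := (hasSum_nat_add_iff (f := fun j => V j (adj (V j).toContinuousLinearMap y)) 1).1 s2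
      rw [Finset.sum_range_one] at s3
      exact s1.unique s3)
  let v : ℕ → E →L[ℂ] H := fun j => (V j).toContinuousLinearMap
  have vn : ∀ j, ‖v j‖ ≤ 1 := fun j => (V j).norm_toContinuousLinearMap_le
  have vn' : ∀ j, ‖adj (v j)‖ ≤ 1 := fun j => by
    rw [LinearIsometryEquiv.norm_map]; exact vn j
  let K : ℕ → E →L[ℂ] H := fun j => T ∘L v j - v j ∘L R
  let K' : ℕ → E →L[ℂ] H := fun j => adj T ∘L v j - v j ∘L adj R
  have hK : ∀ j, BiC (K j) := hk
  have hK' : ∀ j, BiC (K' j) := hk'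
  have hKn : ∀ j, ‖K j‖ ≤ ε * (1/2)^j := hkn
  have hKn' : ∀ j, ‖adj (K' j)‖ ≤ ε * (1/2)^j := fun j => by
    rw [LinearIsometryEquiv.norm_map]; exact hkn' j
  let C : ℕ → H →L[ℂ] H := fun j => (K (j+1) - K j) ∘L adj (v j) - (v (j+1) - v j) ∘L adj (K' j)
  have hC : ∀ j h, C j h = T (v (j+1) (adj (v j) h) - v j (adj (v j) h)) -
      (v (j+1) (adj (v j) (T h)) - v j (adj (v j) (T h))) := by
    intro j h
    have : adj (K' j) h = adj (v j) (T h) - R (adj (v j) h) := by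
      simp only [K', map_sub, ContinuousLinearMap.adjoint_comp, ContinuousLinearMap.adjoint_adjoint,
        ContinuousLinearMap.sub_apply, ContinuousLinearMap.comp_apply]
    simp only [C, ContinuousLinearMap.sub_apply, ContinuousLinearMap.comp_apply, this, K, map_sub]
    abel
  have hCb : ∀ j, BiC (C j) := fun j =>
    (((hK (j+1)).sub' (hK j)).right _).sub' ((hK' j).adj.left _)
  have hCn : ∀ j, ‖C j‖ ≤ 4 * ε * (1/2)^j := by
    intro j
    have b0 : ε * (1/2)^(j+1) ≤ ε * (1/2)^j := by
      have : (0:ℝ) ≤ ε * (1/2)^j := by positivity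
      rw [pow_succ]; linarith
    have b1 : ‖(K (j+1) - K j) ∘L adj (v j)‖ ≤ (ε * (1/2)^j + ε * (1/2)^j) * 1 := by
      refine (ContinuousLinearMap.opNorm_comp_le _ _).trans ?_
      gcongr
      · exact (norm_sub_le _ _).trans (add_le_add ((hKn (j+1)).trans b0) (hKn j))
      · exact vn' j
    have b2 : ‖(v (j+1) - v j) ∘L adj (K' j)‖ ≤ (1 + 1) * (ε * (1/2)^j) := by
      refine (ContinuousLinearMap.opNorm_comp_le _ _).trans ?_
      gcongr
      · exact (norm_sub_le _ _).trans (add_le_add (vn _) (vn _))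
      · exact hKn' j
    have := (norm_sub_le ((K (j+1) - K j) ∘L adj (v j)) ((v (j+1) - v j) ∘L adj (K' j)))
    calc ‖C j‖ ≤ _ := this
      _ ≤ (ε * (1/2)^j + ε * (1/2)^j) * 1 + (1 + 1) * (ε * (1/2)^j) := add_le_add b1 b2
      _ = _ := by ring
  have hgeo : HasSum (fun k : ℕ => 4 * ε * (1/2 : ℝ)^k) (8 * ε) := by
    have := (hasSum_geometric_two).mul_left (4 * ε)
    rwa [show 4 * ε * 2 = 8 * ε by ring] at this
  have hsum : Summable C := Summable.of_norm_bounded hgeo.summable hCn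
  have hDb := BiC.hasSum C hCb _ hsum.hasSum
  have hDn : ‖∑' j, C j‖ ≤ 8 * ε := tsum_of_norm_bounded hgeo hCn
  let Q : H → H := fun h => Vp (adj Vt.toContinuousLinearMap h) - Vt (adj Vt.toContinuousLinearMap h)
  have hQ : ∀ h, HasSum (fun j => v (j+1) (adj (v j) h) - v j (adj (v j) h)) (Q h) := by
    intro h
    have s1 := hVt1 (adj Vt.toContinuousLinearMap h)
    have s2 := hVp1 (adj Vt.toContinuousLinearMap h)
    simp only [hVt2] at s1 s2
    exact s2.sub s1
  have hDQ : ∀ h, (∑' j, C j) h = T (Q h) - Q (T h) := by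
    intro h
    have s1 : HasSum (fun k => C k h) ((∑' k, C k) h) :=
      hsum.hasSum.mapL (ContinuousLinearMap.apply ℂ H h)
    simp only [hC] at s1
    have s2 := (hQ h).mapL T
    exact s1.unique (s2.sub (hQ (T h)))
  set D := ∑' j, C j
  have hi : ∀ m, adj ι.toContinuousLinearMap (That m) = T (adj ι.toContinuousLinearMap m) ∧
      adj κ.toContinuousLinearMap (That m) = R (adj κ.toContinuousLinearMap m) := by
    intro m
    have aik : ∀ x, adj ι.toContinuousLinearMap (κ x) = 0 := by
      intro x
      apply ext_inner_left ℂ; intro y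
      rw [ContinuousLinearMap.adjoint_inner_right, inner_zero_right]; exact hικ y x
    have aki : ∀ x, adj κ.toContinuousLinearMap (ι x) = 0 := by
      intro x
      apply ext_inner_left ℂ; intro y
      rw [ContinuousLinearMap.adjoint_inner_right, inner_zero_right, inner_eq_zero_symm]; exact hικ x y
    have : That m = ι (T (adj ι.toContinuousLinearMap m)) + κ (R (adj κ.toContinuousLinearMap m)) := by
      conv_lhs => rw [← hdec m]
      rw [map_add, hTι, hTκ]
    rw [this, map_add, map_add, isom_adj_apply, isom_adj_apply, aik, aki, add_zero, zero_add]
    exact ⟨rfl, rfl⟩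
  have hfin : T ∘L (U.toContinuousLinearEquiv : M →L[ℂ] H) -
        (U.toContinuousLinearEquiv : M →L[ℂ] H) ∘L That =
        D ∘L adj ι.toContinuousLinearMap + K 0 ∘L adj κ.toContinuousLinearMap := by
    ext m
    have e1 : ∀ m, U m = adj ι.toContinuousLinearMap m + Q (adj ι.toContinuousLinearMap m)
        + V 0 (adj κ.toContinuousLinearMap m) := by
      intro m; rw [hU]; simp only [Q]; abel
    show T (U m) - U (That m) = D (adj ι.toContinuousLinearMap m) +
      (T (V 0 (adj κ.toContinuousLinearMap m)) - V 0 (R (adj κ.toContinuousLinearMap m)))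
    rw [e1, e1, (hi m).1, (hi m).2, hDQ, map_add, map_add]
    abel
  refine ⟨U, ?_, ?_⟩
  · rw [hfin]
    exact ((hDb.right _).add' ((hK 0).right _)).1
  · rw [hfin]
    have nι : ‖adj ι.toContinuousLinearMap‖ ≤ 1 := by
      rw [LinearIsometryEquiv.norm_map]; exact ι.norm_toContinuousLinearMap_le
    have nκ : ‖adj κ.toContinuousLinearMap‖ ≤ 1 := by
      rw [LinearIsometryEquiv.norm_map]; exact κ.norm_toContinuousLinearMap_le
    have b1 : ‖D ∘L adj ι.toContinuousLinearMap‖ ≤ 8 * ε * 1 :=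
      (ContinuousLinearMap.opNorm_comp_le _ _).trans (by gcongr)
    have b2 : ‖K 0 ∘L adj κ.toContinuousLinearMap‖ ≤ ε * (1/2)^0 * 1 :=
      (ContinuousLinearMap.opNorm_comp_le _ _).trans (by gcongr; exact hKn 0)
    calc _ ≤ _ := norm_add_le _ _
      _ ≤ 8 * ε * 1 + ε * (1/2)^0 * 1 := add_le_add b1 b2
      _ = _ := by ring
end Absorption


section Ultra
open scoped BoundedContinuousFunction

lemma hyper_bdd_tendsto (f : ℕ → ℂ) (c : ℝ) (h : ∀ n, ‖f n‖ ≤ c) :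
    ∃ z, Tendsto f (hyperfilter ℕ : Filter ℕ) (𝓝 z) := by
  have hc : IsCompact (Metric.closedBall (0:ℂ) c) := isCompact_closedBall _ _
  obtain ⟨z, -, hz⟩ := hc.ultrafilter_le_nhds ((hyperfilter ℕ).map f) (by
    rw [le_principal_iff]
    exact Filter.mem_map.2 (Filter.univ_mem' fun n => by simpa using h n))
  exact ⟨z, hz⟩

lemma bcf_inner_tendsto {H : Type*} [NormedAddCommGroup H] [InnerProductSpace ℂ H] (x y : ℕ →ᵇ H) :
    ∃ z, Tendsto (fun n => inner ℂ (x n) (y n)) (hyperfilter ℕ : Filter ℕ) (𝓝 z) :=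
  hyper_bdd_tendsto _ (‖x‖ * ‖y‖) fun n => (norm_inner_le_norm _ _).trans
    (mul_le_mul (x.norm_coe_le_norm n) (y.norm_coe_le_norm n) (norm_nonneg _) (norm_nonneg _))

/-- Bounded sequences, as a carrier for the ultraproduct seminorm. -/
def UPre (H : Type*) [NormedAddCommGroup H] [InnerProductSpace ℂ H] : Type _ := ℕ →ᵇ H

noncomputable instance (H : Type*) [NormedAddCommGroup H] [InnerProductSpace ℂ H] : AddCommGroup (UPre H) :=
  inferInstanceAs (AddCommGroup (ℕ →ᵇ H))

noncomputable instance (H : Type*) [NormedAddCommGroup H] [InnerProductSpace ℂ H] : Module ℂ (UPre H) :=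
  inferInstanceAs (Module ℂ (ℕ →ᵇ H))

/-- Identification. -/
noncomputable def UPre.mk' (H : Type*) [NormedAddCommGroup H] [InnerProductSpace ℂ H] :
    (ℕ →ᵇ H) ≃ₗ[ℂ] UPre H := LinearEquiv.refl ℂ (ℕ →ᵇ H)

/-- The value at `n`. -/
noncomputable def UPre.val {H : Type*} [NormedAddCommGroup H] [InnerProductSpace ℂ H] (x : UPre H) : ℕ →ᵇ H :=
  (UPre.mk' H).symm x

/-- limit of inner products -/
noncomputable def UPre.lim {H : Type*} [NormedAddCommGroup H] [InnerProductSpace ℂ H] (x y : UPre H) : ℂ :=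
  Classical.choose (bcf_inner_tendsto x.val y.val)

lemma UPre.lim_spec {H : Type*} [NormedAddCommGroup H] [InnerProductSpace ℂ H] (x y : UPre H) :
    Tendsto (fun n => inner ℂ (x.val n) (y.val n)) (hyperfilter ℕ : Filter ℕ) (𝓝 (x.lim y)) :=
  Classical.choose_spec (bcf_inner_tendsto x.val y.val)

/-- pre-inner product -/
@[reducible] noncomputable def UPre.core (H : Type*) [NormedAddCommGroup H] [InnerProductSpace ℂ H] :
    PreInnerProductSpace.Core ℂ (UPre H) where
  inner x y := x.lim y
  conj_inner_symm x y := by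
    refine tendsto_nhds_unique ?_ (UPre.lim_spec x y)
    have := (Complex.continuous_conj.tendsto _).comp (UPre.lim_spec y x)
    refine this.congr fun n => ?_
    exact inner_conj_symm _ _
  re_inner_nonneg x := by
    have := (Complex.continuous_re.tendsto _).comp (UPre.lim_spec x x)
    refine ge_of_tendsto' this fun n => ?_
    exact inner_self_nonneg (𝕜 := ℂ)
  add_left x y z := by
    refine tendsto_nhds_unique (UPre.lim_spec (x+y) z) ?_
    refine ((UPre.lim_spec x z).add (UPre.lim_spec y z)).congr fun n => ?_
    exact (inner_add_left _ _ _).symm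
  smul_left x y r := by
    refine tendsto_nhds_unique (UPre.lim_spec (r • x) y) ?_
    refine ((UPre.lim_spec x y).const_mul _).congr fun n => ?_
    exact (inner_smul_left _ _ _).symm

noncomputable instance (H : Type*) [NormedAddCommGroup H] [InnerProductSpace ℂ H] :
    SeminormedAddCommGroup (UPre H) :=
  letI := UPre.core H
  InnerProductSpace.Core.toSeminormedAddCommGroup (𝕜 := ℂ)

noncomputable instance (H : Type*) [NormedAddCommGroup H] [InnerProductSpace ℂ H] :
    InnerProductSpace ℂ (UPre H) :=
  InnerProductSpace.ofCore (UPre.core H)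

lemma UPre.inner_tendsto {H : Type*} [NormedAddCommGroup H] [InnerProductSpace ℂ H] (x y : UPre H) :
    Tendsto (fun n => inner ℂ (x.val n) (y.val n)) (hyperfilter ℕ : Filter ℕ) (𝓝 (inner ℂ x y)) :=
  UPre.lim_spec x y

lemma tendsto_norm_of_inner {H Q : Type*} [NormedAddCommGroup H] [InnerProductSpace ℂ H]
    [SeminormedAddCommGroup Q] [InnerProductSpace ℂ Q] (l : Filter ℕ) (x : ℕ → H) (q : Q)
    (h : Tendsto (fun n => inner ℂ (x n) (x n)) l (𝓝 (inner ℂ q q))) :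
    Tendsto (fun n => ‖x n‖) l (𝓝 ‖q‖) := by
  have h1 := (Real.continuous_sqrt.tendsto _).comp ((Complex.continuous_re.tendsto _).comp h)
  have e : √(inner ℂ q q).re = ‖q‖ := (norm_eq_sqrt_re_inner (𝕜 := ℂ) q).symm
  rw [e] at h1
  refine h1.congr fun n => ?_
  exact (norm_eq_sqrt_re_inner (𝕜 := ℂ) (x n)).symm

lemma exists_ultrapower.{u} (H : Type u) [NormedAddCommGroup H] [InnerProductSpace ℂ H] [CompleteSpace H] :
    ∃ (Q : Type u) (_ : NormedAddCommGroup Q) (_ : InnerProductSpace ℂ Q) (_ : CompleteSpace Q)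
      (mk : (ℕ →ᵇ H) →ₗ[ℂ] Q), Function.Surjective mk ∧
      ∀ x y : ℕ →ᵇ H, Tendsto (fun n => inner ℂ (x n) (y n)) (hyperfilter ℕ : Filter ℕ)
        (𝓝 (inner ℂ (mk x) (mk y))) := by
  let mk : (ℕ →ᵇ H) →ₗ[ℂ] SeparationQuotient (UPre H) :=
    (SeparationQuotient.mkCLM ℂ (UPre H)).toLinearMap ∘ₗ (UPre.mk' H).toLinearMap
  have hsurj : Function.Surjective mk := by
    intro q
    obtain ⟨x, rfl⟩ := SeparationQuotient.surjective_mk q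
    exact ⟨x.val, rfl⟩
  have hin : ∀ x y : ℕ →ᵇ H, Tendsto (fun n => inner ℂ (x n) (y n)) (hyperfilter ℕ : Filter ℕ)
        (𝓝 (inner ℂ (mk x) (mk y))) := fun x y => UPre.inner_tendsto (UPre.mk' H x) (UPre.mk' H y)
  have hnorm : ∀ x, Tendsto (fun n => ‖x n‖) (hyperfilter ℕ : Filter ℕ) (𝓝 ‖mk x‖) :=
    fun x => tendsto_norm_of_inner _ _ _ (hin x x)
  have hle : ∀ x, ‖mk x‖ ≤ 1 * ‖x‖ := fun x => by
    rw [one_mul]; exact le_of_tendsto' (hnorm x) fun n => x.norm_coe_le_norm n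
  have htr : ∀ (q : SeparationQuotient (UPre H)) (r : ℝ), ‖q‖ < r → ∃ x, mk x = q ∧ ‖x‖ ≤ r := by
    intro q r hr
    obtain ⟨x, rfl⟩ := hsurj q
    have hr0 : 0 ≤ r := (norm_nonneg _).trans hr.le
    let x' : ℕ →ᵇ H := BoundedContinuousFunction.ofNormedAddCommGroupDiscrete
      (fun n => if ‖x n‖ ≤ r then x n else 0) r (fun n => by
        split_ifs with h
        · exact h
        · simpa using hr0)
    refine ⟨x', ?_, (BoundedContinuousFunction.norm_le hr0).2 fun n => ?_⟩
    · rw [← sub_eq_zero, ← map_sub, ← norm_eq_zero]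
      refine tendsto_nhds_unique (hnorm _) (tendsto_const_nhds.congr' ?_)
      filter_upwards [(hnorm x).eventually (gt_mem_nhds hr)] with n hn
      show 0 = ‖x' n - x n‖
      have : x' n = x n := by
        show (if ‖x n‖ ≤ r then x n else 0) = x n
        rw [if_pos hn.le]
      rw [this]; simp
    · show ‖(if ‖x n‖ ≤ r then x n else 0)‖ ≤ r
      split_ifs with h
      · exact h
      · simpa using hr0
  refine ⟨SeparationQuotient (UPre H), inferInstance, inferInstance, ?_, mk, hsurj, hin⟩
  apply NormedAddCommGroup.completeSpace_of_summable_imp_tendsto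
  intro u hu
  have h1 := fun n => htr (u n) (‖u n‖ + (1/2)^n) (by have : (0:ℝ) < (1/2)^n := by positivity
                                                      linarith)
  choose x hx1 hx2 using h1
  have hs : Summable x := Summable.of_norm_bounded (hu.add summable_geometric_two) hx2
  let mkc : (ℕ →ᵇ H) →L[ℂ] SeparationQuotient (UPre H) := mk.mkContinuous 1 hle
  have h2 := (hs.hasSum.mapL mkc).tendsto_sum_nat
  refine ⟨mkc (∑' i, x i), ?_⟩
  refine h2.congr fun n => Finset.sum_congr rfl fun i _ => hx1 i

end Ultra


section GS

lemma tendsto_norm_of_sub {H : Type*} [NormedAddCommGroup H] (l : Filter ℕ) (u v : ℕ → H) (c : ℝ)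
    (h : Tendsto (fun n => u n - v n) l (𝓝 0)) (hv : Tendsto (fun n => ‖v n‖) l (𝓝 c)) :
    Tendsto (fun n => ‖u n‖) l (𝓝 c) := by
  have h1 : Tendsto (fun n => ‖u n‖ - ‖v n‖) l (𝓝 0) := by
    refine squeeze_zero_norm (fun n => ?_) (tendsto_zero_iff_norm_tendsto_zero.1 h)
    exact abs_norm_sub_norm_le _ _
  have := h1.add hv
  simpa using this

lemma tendsto_inner_zero_of_bdd {H : Type*} [NormedAddCommGroup H] [InnerProductSpace ℂ H]
    (l : Filter ℕ) (u v : ℕ → H) (c : ℝ)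
    (h : Tendsto u l (𝓝 0)) (hv : Tendsto (fun n => ‖v n‖) l (𝓝 c)) :
    Tendsto (fun n => inner ℂ (u n) (v n)) l (𝓝 0) := by
  have h1 := (tendsto_zero_iff_norm_tendsto_zero.1 h).mul hv
  rw [zero_mul] at h1
  exact squeeze_zero_norm (fun n => norm_inner_le_norm _ _) h1

lemma gs_approx {H : Type*} [NormedAddCommGroup H] [InnerProductSpace ℂ H] {d : ℕ} (l : Filter ℕ)
    (y : Fin d → ℕ → H)
    (hy : ∀ i j, i ≠ j → Tendsto (fun n => inner ℂ (y i n) (y j n)) l (𝓝 0))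
    (hy1 : ∀ i, Tendsto (fun n => ‖y i n‖) l (𝓝 1)) :
    ∃ w : Fin d → ℕ → H, (∀ᶠ n in l, Orthonormal ℂ (fun i => w i n)) ∧
      (∀ i, Tendsto (fun n => w i n - y i n) l (𝓝 0)) ∧
      (∀ i n, w i n ∈ Submodule.span ℂ (Set.range (fun i => y i n))) := by
  let g : Fin d → ℕ → H := fun i n => InnerProductSpace.gramSchmidt ℂ (fun i => y i n) i
  have hg : ∀ i, Tendsto (fun n => g i n - y i n) l (𝓝 0) := by
    intro i
    induction i using WellFoundedLT.induction with
    | ind i ih =>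
      have e : ∀ n, g i n - y i n = - ∑ j ∈ Finset.Iio i,
          (inner ℂ (g j n) (y i n) / (‖g j n‖ : ℂ) ^ 2) • g j n := by
        intro n
        have := InnerProductSpace.gramSchmidt_def'' ℂ (fun i => y i n) i
        have h2 : y i n = g i n + ∑ j ∈ Finset.Iio i,
          (inner ℂ (g j n) (y i n) / (‖g j n‖ : ℂ) ^ 2) • g j n := this
        conv_lhs => rw [h2]
        abel
      simp only [e]
      rw [← neg_zero, ← Finset.sum_const_zero (s := Finset.Iio i)]
      apply Tendsto.neg
      apply tendsto_finsetSum
      intro j hj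
      have hji : j < i := Finset.mem_Iio.1 hj
      have n1 := tendsto_norm_of_sub l _ _ _ (ih j hji) (hy1 j)
      have i1 : Tendsto (fun n => inner ℂ (g j n) (y i n)) l (𝓝 0) := by
        have a1 := tendsto_inner_zero_of_bdd l _ _ _ (ih j hji) (hy1 i)
        have a2 := a1.add (hy j i hji.ne)
        rw [zero_add] at a2
        refine a2.congr fun n => ?_
        rw [← inner_add_left, sub_add_cancel]
      have s1 : Tendsto (fun n => ‖inner ℂ (g j n) (y i n)‖ / ‖g j n‖^2 * ‖g j n‖) l (𝓝 (0 / 1^2 * 1)) := by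
        have := (tendsto_zero_iff_norm_tendsto_zero.1 i1)
        exact (this.div (n1.pow 2) (by norm_num)).mul n1
      rw [zero_div, zero_mul] at s1
      refine squeeze_zero_norm (fun n => ?_) s1
      rw [norm_smul, norm_div, norm_pow]
      simp
  have hgn : ∀ i, Tendsto (fun n => ‖g i n‖) l (𝓝 1) := fun i =>
    tendsto_norm_of_sub l _ _ _ (hg i) (hy1 i)
  have hpos : ∀ᶠ n in l, ∀ i, 0 < ‖g i n‖ := by
    rw [Filter.eventually_all]
    intro i
    exact (hgn i).eventually (lt_mem_nhds one_pos)
  let w : Fin d → ℕ → H := fun i n => (‖g i n‖ : ℂ)⁻¹ • g i n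
  refine ⟨w, ?_, ?_, ?_⟩
  · filter_upwards [hpos] with n hn
    constructor
    · intro i
      have := (hn i).ne'
      simp only [w, norm_smul, norm_inv, Complex.norm_real, norm_norm]
      field_simp
    · intro i j hij
      have := InnerProductSpace.gramSchmidt_orthogonal ℂ (fun i => y i n) hij
      have h2 : inner ℂ (g i n) (g j n) = 0 := this
      simp only [w, inner_smul_left, inner_smul_right, h2, mul_zero]
  · intro i
    have a1 : Tendsto (fun n => w i n - g i n) l (𝓝 0) := by
      have b1 : Tendsto (fun n => |1 - ‖g i n‖|) l (𝓝 0) := by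
        have := ((tendsto_const_nhds (x := (1:ℝ))).sub (hgn i)).abs
        simpa using this
      rw [tendsto_zero_iff_norm_tendsto_zero]
      refine b1.congr' ?_
      filter_upwards [hpos] with n hn
      have h0 : (‖g i n‖ : ℂ) ≠ 0 := by exact_mod_cast (hn i).ne'
      have e : w i n - g i n = (((1 - ‖g i n‖ : ℝ) : ℂ) * (‖g i n‖ : ℂ)⁻¹) • g i n := by
        simp only [w]
        rw [show (((1 - ‖g i n‖ : ℝ) : ℂ) * (‖g i n‖ : ℂ)⁻¹) = (‖g i n‖ : ℂ)⁻¹ - 1 by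
          push_cast; field_simp, sub_smul, one_smul]
      rw [e, norm_smul, norm_mul, norm_inv, Complex.norm_real, Complex.norm_real, norm_norm, mul_assoc,
        inv_mul_cancel₀ (hn i).ne', mul_one, Real.norm_eq_abs]
    have := a1.add (hg i)
    rw [add_zero] at this
    refine this.congr fun n => ?_
    abel
  · intro i n
    apply Submodule.smul_mem
    rw [← InnerProductSpace.span_gramSchmidt ℂ (fun i => y i n)]
    exact Submodule.subset_span ⟨i, rfl⟩
end GS

section UltraOps
open scoped BoundedContinuousFunction
variable {H Q : Type*} [NormedAddCommGroup H] [InnerProductSpace ℂ H] [CompleteSpace H]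
  [NormedAddCommGroup Q] [InnerProductSpace ℂ Q] [CompleteSpace Q]

/-- Applying a bounded sequence of operators to a bounded sequence of vectors. -/
noncomputable def bcfMap (A : ℕ → H →L[ℂ] H) (c : ℝ) (hA : ∀ n, ‖A n‖ ≤ c) (x : ℕ →ᵇ H) : ℕ →ᵇ H :=
  BoundedContinuousFunction.ofNormedAddCommGroupDiscrete (fun n => A n (x n)) (c * ‖x‖) fun n =>
    ((A n).le_opNorm _).trans (mul_le_mul (hA n) (x.norm_coe_le_norm n) (norm_nonneg _)
      ((norm_nonneg _).trans (hA n)))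

lemma bcfMap_apply (A : ℕ → H →L[ℂ] H) (c : ℝ) (hA : ∀ n, ‖A n‖ ≤ c) (x : ℕ →ᵇ H) (n : ℕ) :
    bcfMap A c hA x n = A n (x n) := rfl

/-- the interface of the ultrapower -/
def IsUP (mk : (ℕ →ᵇ H) →ₗ[ℂ] Q) : Prop := Function.Surjective mk ∧
      ∀ x y : ℕ →ᵇ H, Tendsto (fun n => inner ℂ (x n) (y n)) (hyperfilter ℕ : Filter ℕ)
        (𝓝 (inner ℂ (mk x) (mk y)))

lemma IsUP.norm {mk : (ℕ →ᵇ H) →ₗ[ℂ] Q} (h : IsUP mk) (x : ℕ →ᵇ H) :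
    Tendsto (fun n => ‖x n‖) (hyperfilter ℕ : Filter ℕ) (𝓝 ‖mk x‖) :=
  tendsto_norm_of_inner _ _ _ (h.2 x x)

lemma IsUP.eq_iff {mk : (ℕ →ᵇ H) →ₗ[ℂ] Q} (h : IsUP mk) (x y : ℕ →ᵇ H) :
    mk x = mk y ↔ Tendsto (fun n => x n - y n) (hyperfilter ℕ : Filter ℕ) (𝓝 0) := by
  have h1 := h.norm (x - y)
  rw [tendsto_zero_iff_norm_tendsto_zero, ← sub_eq_zero, ← map_sub, ← norm_eq_zero]
  constructor
  · intro e
    rw [e] at h1; exact h1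
  · intro e
    exact tendsto_nhds_unique h1 e

lemma IsUP.op {mk : (ℕ →ᵇ H) →ₗ[ℂ] Q} (h : IsUP mk) (A : ℕ → H →L[ℂ] H) (c : ℝ) (hA : ∀ n, ‖A n‖ ≤ c) :
    ∃ B : Q →L[ℂ] Q, ‖B‖ ≤ c ∧ ∀ x y : ℕ →ᵇ H, (∀ n, y n = A n (x n)) → B (mk x) = mk y := by
  have hc : 0 ≤ c := (norm_nonneg _).trans (hA 0)
  have key : ∀ x y x' y' : ℕ →ᵇ H, (∀ n, y n = A n (x n)) → (∀ n, y' n = A n (x' n)) → mk x = mk x' →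
      mk y = mk y' := by
    intro x y x' y' hy hy' e
    rw [h.eq_iff] at e ⊢
    have e1 := (tendsto_zero_iff_norm_tendsto_zero.1 e).const_mul c
    rw [mul_zero] at e1
    refine squeeze_zero_norm (fun n => ?_) e1
    rw [hy, hy', ← map_sub]
    exact ((A n).le_opNorm _).trans (by gcongr; exact hA n)
  choose s hs using h.1
  let L : Q →ₗ[ℂ] Q :=
    { toFun := fun q => mk (bcfMap A c hA (s q))
      map_add' := fun p q => by
        rw [← map_add]
        refine key (s (p+q)) _ (s p + s q) _ (fun n => rfl) (fun n => ?_) (by rw [map_add, hs, hs, hs])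
        simp [bcfMap_apply]
      map_smul' := fun a q => by
        rw [RingHom.id_apply, ← map_smul]
        refine key (s (a • q)) _ (a • s q) _ (fun n => rfl) (fun n => ?_) (by rw [map_smul, hs, hs])
        simp [bcfMap_apply] }
  have hL : ∀ q, ‖L q‖ ≤ c * ‖q‖ := by
    intro q
    have h1 := h.norm (bcfMap A c hA (s q))
    have h2 := (h.norm (s q)).const_mul c
    rw [hs] at h2
    refine le_of_tendsto_of_tendsto' h1 h2 fun n => ?_
    rw [bcfMap_apply]
    exact ((A n).le_opNorm _).trans (by gcongr; exact hA n)
  refine ⟨L.mkContinuous c hL, L.mkContinuous_norm_le hc hL, ?_⟩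
  intro x y hy
  exact key (s (mk x)) _ x _ (fun n => rfl) hy (hs _)

lemma IsUP.op_adj {mk : (ℕ →ᵇ H) →ₗ[ℂ] Q} (h : IsUP mk) (A : ℕ → H →L[ℂ] H) (c : ℝ) (hA : ∀ n, ‖A n‖ ≤ c)
    (B : Q →L[ℂ] Q) (hB : ∀ x y : ℕ →ᵇ H, (∀ n, y n = A n (x n)) → B (mk x) = mk y) :
    ∀ x y : ℕ →ᵇ H, (∀ n, y n = ContinuousLinearMap.adjoint (A n) (x n)) →
      ContinuousLinearMap.adjoint B (mk x) = mk y := by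
  intro x y hy
  apply ext_inner_left ℂ
  intro q
  obtain ⟨z, rfl⟩ := h.1 q
  rw [ContinuousLinearMap.adjoint_inner_right, hB z (bcfMap A c hA z) (fun n => rfl)]
  refine tendsto_nhds_unique (h.2 _ _) ((h.2 z y).congr fun n => ?_)
  rw [hy, bcfMap_apply, ContinuousLinearMap.adjoint_inner_right]

end UltraOps


section UltraAbsorb
open scoped BoundedContinuousFunction
variable {H Q E : Type*} [NormedAddCommGroup H] [InnerProductSpace ℂ H] [CompleteSpace H]
  [NormedAddCommGroup Q] [InnerProductSpace ℂ Q] [CompleteSpace Q]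
  [NormedAddCommGroup E] [InnerProductSpace ℂ E] [CompleteSpace E]

lemma sub_repr {E : Type*}
    [NormedAddCommGroup E] [InnerProductSpace ℂ E] (F : Submodule ℂ E) {m : ℕ}
    (c : OrthonormalBasis (Fin m) ℂ F) (x : E) (hx : x ∈ F) :
    x = ∑ k, (inner ℂ (c k : E) x) • (c k : E) := by
  have := c.sum_repr' (⟨x, hx⟩ : F)
  have h2 := congrArg (Subtype.val) this
  rw [AddSubmonoidClass.coe_finset_sum] at h2
  exact h2.symm

lemma fd_bound {E H : Type*} [NormedAddCommGroup H] [InnerProductSpace ℂ H]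
    [NormedAddCommGroup E] [InnerProductSpace ℂ E] (F : Submodule ℂ E) {m : ℕ}
    (c : OrthonormalBasis (Fin m) ℂ F) (B : E →L[ℂ] H) (δ : ℝ) (hB : ∀ k, ‖B (c k : E)‖ ≤ δ) :
    ∀ x ∈ F, ‖B x‖ ≤ (m * δ) * ‖x‖ := by
  intro x hx
  have e : x = ∑ k, (inner ℂ (c k : E) x) • (c k : E) := by
    exact sub_repr F c x hx
  conv_lhs => rw [e]
  rw [map_sum]
  refine (norm_sum_le _ _).trans ?_
  have : ∀ k ∈ Finset.univ, ‖B ((inner ℂ (c k : E) x) • (c k : E))‖ ≤ δ * ‖x‖ := by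
    intro k _
    rw [map_smul, norm_smul]
    have n1 : ‖inner ℂ (c k : E) x‖ ≤ ‖x‖ := by
      refine (norm_inner_le_norm _ _).trans ?_
      have : ‖(c k : E)‖ = 1 := c.orthonormal.1 k
      rw [this, one_mul]
    calc _ ≤ ‖x‖ * δ := mul_le_mul n1 (hB k) (norm_nonneg _) (norm_nonneg _)
      _ = _ := mul_comm _ _
  refine (Finset.sum_le_card_nsmul _ _ _ this).trans ?_
  simp [mul_assoc]

lemma proj_tendsto_zero (G : Submodule ℂ H) [FiniteDimensional ℂ G] (l : Filter ℕ) (x : ℕ → H)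
    (h : ∀ g, Tendsto (fun n => inner ℂ g (x n)) l (𝓝 0)) :
    Tendsto (fun n => G.starProjection (x n)) l (𝓝 0) := by
  let c := stdOrthonormalBasis ℂ G
  have e : ∀ y : H, G.starProjection y = ∑ k, (inner ℂ (c k : H) y) • (c k : H) := by
    intro y
    have := c.sum_repr' (G.orthogonalProjectionOnto y)
    have h2 := congrArg (Subtype.val) this
    have h3 : G.starProjection y = (G.orthogonalProjectionOnto y : H) := rfl
    rw [h3, ← h2]
    rw [AddSubmonoidClass.coe_finset_sum]
    refine Finset.sum_congr rfl fun k _ => ?_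
    rw [Submodule.coe_smul]
    congr 1
    exact Submodule.inner_orthogonalProjection_eq_of_mem_left (c k) y
  simp only [e]
  rw [← Finset.sum_const_zero (s := (Finset.univ : Finset (Fin (Module.finrank ℂ G))))]
  apply tendsto_finsetSum
  intro k _
  have := (h (c k)).smul_const (c k : H)
  rwa [zero_smul] at this

lemma orthonormal_norm_sum {d : ℕ} {H : Type*} [NormedAddCommGroup H] [InnerProductSpace ℂ H]
    (w : Fin d → H) (hw : Orthonormal ℂ w) (a : Fin d → ℂ) :
    ‖∑ i, a i • w i‖^2 = ∑ i, ‖a i‖^2 := by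
  have h := hw.inner_sum a a Finset.univ
  rw [inner_self_eq_norm_sq_to_K] at h
  have h2 : ((‖∑ i, a i • w i‖^2 : ℝ) : ℂ) = ((∑ i, ‖a i‖^2 : ℝ) : ℂ) := by
    push_cast
    refine h.trans (Finset.sum_congr rfl fun i _ => ?_)
    exact Complex.conj_mul' _
  exact_mod_cast h2

lemma IsUP.absorbs {mk : (ℕ →ᵇ H) →ₗ[ℂ] Q} (h : IsUP mk) (κ : E →ₗᵢ[ℂ] Q)
    (hκ : ∀ g e, inner ℂ (mk (BoundedContinuousFunction.const ℕ g)) (κ e) = 0)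
    (T : H →L[ℂ] H) (R : E →L[ℂ] E)
    (B : Q →L[ℂ] Q) (hB : ∀ x y : ℕ →ᵇ H, (∀ n, y n = T (x n)) → B (mk x) = mk y)
    (hR : ∀ e, B (κ e) = κ (R e))
    (hR' : ∀ e, ContinuousLinearMap.adjoint B (κ e) = κ (ContinuousLinearMap.adjoint R e)) :
    OpAbsorbs T R := by
  intro F G hF hG ε hε
  have hB' := h.op_adj (fun _ => T) ‖T‖ (fun _ => le_rfl) B hB
  let F' : Submodule ℂ E := F ⊔ F.map (R : E →ₗ[ℂ] E) ⊔
    F.map (ContinuousLinearMap.adjoint R : E →ₗ[ℂ] E)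
  haveI : FiniteDimensional ℂ F' := by infer_instance
  have m1 : ∀ x ∈ F, x ∈ F' := fun x hx => (le_sup_left.trans le_sup_left : F ≤ F') hx
  have m2 : ∀ x ∈ F, R x ∈ F' := fun x hx =>
    (le_sup_right.trans le_sup_left : F.map (R : E →ₗ[ℂ] E) ≤ F') (Submodule.mem_map_of_mem hx)
  have m3 : ∀ x ∈ F, ContinuousLinearMap.adjoint R x ∈ F' := fun x hx =>
    (le_sup_right : F.map (ContinuousLinearMap.adjoint R : E →ₗ[ℂ] E) ≤ F') (Submodule.mem_map_of_mem hx)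
  let b := stdOrthonormalBasis ℂ F'
  have hb : Orthonormal ℂ (fun i => (b i : E)) := b.orthonormal.comp_linearIsometry F'.subtypeₗᵢ
  choose x hx using fun i => h.1 (κ (b i : E))
  have hwk : ∀ i g, Tendsto (fun n => inner ℂ g (x i n)) (hyperfilter ℕ : Filter ℕ) (𝓝 0) := by
    intro i g
    have := h.2 (BoundedContinuousFunction.const ℕ g) (x i)
    rw [hx, hκ] at this
    exact this
  let y : Fin (Module.finrank ℂ F') → ℕ → H := fun i n => x i n - G.starProjection (x i n)
  have hyx : ∀ i, Tendsto (fun n => y i n - x i n) (hyperfilter ℕ : Filter ℕ) (𝓝 0) := by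
    intro i
    have := (proj_tendsto_zero G _ (fun n => x i n) (hwk i)).neg
    rw [neg_zero] at this
    refine this.congr fun n => ?_
    simp only [y]; abel
  have hxn : ∀ i, Tendsto (fun n => ‖x i n‖) (hyperfilter ℕ : Filter ℕ) (𝓝 1) := by
    intro i
    have := h.norm (x i)
    rwa [hx, κ.norm_map, hb.1 i] at this
  have hyn : ∀ i, Tendsto (fun n => ‖y i n‖) (hyperfilter ℕ : Filter ℕ) (𝓝 1) := fun i =>
    tendsto_norm_of_sub _ _ _ _ (hyx i) (hxn i)
  have hyo : ∀ i j, i ≠ j → Tendsto (fun n => inner ℂ (y i n) (y j n)) (hyperfilter ℕ : Filter ℕ) (𝓝 0) := by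
    intro i j hij
    have a1 := tendsto_inner_zero_of_bdd _ _ _ _ (hyx i) (hyn j)
    have a2 := tendsto_inner_zero_of_bdd _ _ _ _ (hyx j) (hxn i)
    have a2' := (Complex.continuous_conj.tendsto _).comp a2
    have a3 := h.2 (x i) (x j)
    rw [hx, hx, κ.inner_map_map, hb.2 hij] at a3
    have a4 := (a1.add a2').add a3
    simp only [map_zero, add_zero] at a4
    refine a4.congr fun n => ?_
    simp only [Function.comp_apply, inner_conj_symm]
    have gen : ∀ a b c d : H, inner ℂ (a - b) c + inner ℂ b (c - d) + inner ℂ b d = inner ℂ a c := by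
      intro a b c d
      rw [inner_sub_left, inner_sub_right]
      ring
    exact gen _ _ _ _
  obtain ⟨w, hw1, hw2, hw3⟩ := gs_approx _ y hyo hyn
  have hwx : ∀ i, Tendsto (fun n => w i n - x i n) (hyperfilter ℕ : Filter ℕ) (𝓝 0) := by
    intro i
    have := (hw2 i).add (hyx i)
    rw [add_zero] at this
    refine this.congr fun n => ?_
    abel
  let A : ℕ → E →L[ℂ] H := fun n => ∑ i, (innerSL ℂ (b i : E)).smulRight (w i n)
  have hA : ∀ n e, A n e = ∑ i, (inner ℂ (b i : E) e) • w i n := by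
    intro n e
    simp only [A, ContinuousLinearMap.sum_apply, ContinuousLinearMap.smulRight_apply, innerSL_apply_apply]
  have hrepr : ∀ e ∈ F', e = ∑ k, (inner ℂ (b k : E) e) • (b k : E) := by
    intro e he
    exact sub_repr F' b e he
  have hconv : ∀ e ∈ F', ∀ z : ℕ →ᵇ H, mk z = κ e →
      Tendsto (fun n => A n e - z n) (hyperfilter ℕ : Filter ℕ) (𝓝 0) := by
    intro e he z hz
    let z' : ℕ →ᵇ H := ∑ i, (inner ℂ (b i : E) e) • x i
    have hz' : mk z' = mk z := by
      rw [hz]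
      conv_rhs => rw [hrepr e he]
      simp only [z', map_sum, map_smul, hx]
    have c1 := (h.eq_iff z' z).1 hz'
    have c2 : Tendsto (fun n => ∑ i, (inner ℂ (b i : E) e) • (w i n - x i n))
        (hyperfilter ℕ : Filter ℕ) (𝓝 0) := by
      rw [← Finset.sum_const_zero (s := (Finset.univ : Finset (Fin (Module.finrank ℂ F'))))]
      apply tendsto_finsetSum
      intro k _
      have := (hwx k).const_smul (inner ℂ (b k : E) e)
      rwa [smul_zero] at this
    have c3 := c2.add c1
    rw [add_zero] at c3
    refine c3.congr fun n => ?_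
    have : z' n = ∑ i, (inner ℂ (b i : E) e) • x i n := by
      simp [z', BoundedContinuousFunction.sum_apply]
    rw [hA, this]
    simp only [smul_sub, Finset.sum_sub_distrib]
    abel
  have hT : ∀ e ∈ F, Tendsto (fun n => T (A n e) - A n (R e)) (hyperfilter ℕ : Filter ℕ) (𝓝 0) := by
    intro e he
    obtain ⟨z, hz⟩ := h.1 (κ e)
    have c1 := hconv e (m1 e he) z hz
    let z' := bcfMap (fun _ => T) ‖T‖ (fun _ => le_rfl) z
    have c2 := hconv (R e) (m2 e he) z' (by rw [← hR, ← hz]; exact (hB z z' (fun n => rfl)).symm)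
    have c3 := ((T.continuous.tendsto _).comp c1).sub c2
    rw [map_zero, sub_zero] at c3
    refine c3.congr fun n => ?_
    simp only [Function.comp_apply, z', bcfMap_apply, map_sub]
    abel
  have hT' : ∀ e ∈ F, Tendsto (fun n => T.adjoint (A n e) - A n (R.adjoint e))
      (hyperfilter ℕ : Filter ℕ) (𝓝 0) := by
    intro e he
    obtain ⟨z, hz⟩ := h.1 (κ e)
    have c1 := hconv e (m1 e he) z hz
    let z' := bcfMap (fun _ => T.adjoint) ‖T.adjoint‖ (fun _ => le_rfl) z
    have c2 := hconv (R.adjoint e) (m3 e he) z' (by rw [← hR', ← hz]; exact (hB' z z' (fun n => rfl)).symm)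
    have c3 := ((T.adjoint.continuous.tendsto _).comp c1).sub c2
    rw [map_zero, sub_zero] at c3
    refine c3.congr fun n => ?_
    simp only [Function.comp_apply, z', bcfMap_apply, map_sub]
    abel
  let c := stdOrthonormalBasis ℂ F
  let m := Module.finrank ℂ F
  let δ : ℝ := ε / (m + 1)
  have hδ : 0 < δ := by positivity
  have hmδ : m * δ ≤ ε := by
    have : (m:ℝ) * δ ≤ (m+1) * δ := by gcongr; linarith
    have e2 : ((m:ℝ)+1) * δ = ε := by simp only [δ]; field_simp
    linarith
  have ev1 : ∀ᶠ n in (hyperfilter ℕ : Filter ℕ), ∀ k, ‖T (A n (c k : E)) - A n (R (c k : E))‖ < δ := by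
    rw [Filter.eventually_all]
    intro k
    have := tendsto_zero_iff_norm_tendsto_zero.1 (hT (c k) (c k).2)
    exact this.eventually (gt_mem_nhds hδ)
  have ev2 : ∀ᶠ n in (hyperfilter ℕ : Filter ℕ), ∀ k, ‖T.adjoint (A n (c k : E)) - A n (R.adjoint (c k : E))‖ < δ := by
    rw [Filter.eventually_all]
    intro k
    have := tendsto_zero_iff_norm_tendsto_zero.1 (hT' (c k) (c k).2)
    exact this.eventually (gt_mem_nhds hδ)
  obtain ⟨n, ⟨hn1, hn2⟩, hn3⟩ := ((hw1.and ev1).and ev2).exists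
  have hAn : ∀ e, ‖A n e‖^2 = ∑ i, ‖inner ℂ (b i : E) e‖^2 := by
    intro e
    rw [hA]
    exact orthonormal_norm_sum _ hn1 _
  have hwG : ∀ i, w i n ∈ Gᗮ := by
    intro i
    have : Submodule.span ℂ (Set.range (fun i => y i n)) ≤ Gᗮ := by
      rw [Submodule.span_le]
      rintro _ ⟨j, rfl⟩
      exact Submodule.sub_starProjection_mem_orthogonal _
    exact this (hw3 i n)
  refine ⟨A n, ?_, ?_, ⟨Submodule.span ℂ (Set.range fun i => w i n), ?_, ?_⟩, ?_, ?_, ?_⟩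
  · refine ContinuousLinearMap.opNorm_le_bound _ zero_le_one fun e => ?_
    rw [one_mul]
    have : ‖A n e‖^2 ≤ ‖e‖^2 := by rw [hAn]; exact hb.sum_inner_products_le e
    exact (abs_le_of_sq_le_sq' this (norm_nonneg _)).2
  · intro e he
    have h1 := b.sum_sq_norm_inner_right (⟨e, m1 e he⟩ : F')
    have : ‖A n e‖^2 = ‖e‖^2 := by rw [hAn]; exact h1
    exact (sq_eq_sq₀ (norm_nonneg _) (norm_nonneg _)).1 this
  · exact FiniteDimensional.span_of_finite ℂ (Set.finite_range _)
  · intro e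
    rw [hA]
    exact Submodule.sum_mem _ fun i _ => Submodule.smul_mem _ _ (Submodule.subset_span ⟨i, rfl⟩)
  · intro e g hg
    rw [hA]
    have : ∑ i, (inner ℂ (b i : E) e) • w i n ∈ Gᗮ :=
      Submodule.sum_mem _ fun i _ => Submodule.smul_mem _ _ (hwG i)
    exact (Submodule.mem_orthogonal _ _).1 this g hg
  · intro e he
    refine (fd_bound F c (T ∘L A n - A n ∘L R) δ (fun k => (hn2 k).le) e he).trans ?_
    gcongr
  · intro e he
    refine (fd_bound F c (T.adjoint ∘L A n - A n ∘L R.adjoint) δ (fun k => (hn3 k).le) e he).trans ?_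
    gcongr

end UltraAbsorb


section Assembly
open scoped BoundedContinuousFunction

lemma exists_sep_invariant {Q : Type*} [NormedAddCommGroup Q] [InnerProductSpace ℂ Q]
    (ops : Fin 6 → Q →L[ℂ] Q) (S : Set Q) (hS : TopologicalSpace.IsSeparable S) :
    ∃ M : Submodule ℂ Q, IsClosed (M : Set Q) ∧ TopologicalSpace.IsSeparable (M : Set Q) ∧ S ⊆ M ∧
      ∀ i, ∀ x ∈ M, ops i x ∈ M := by
  let word : List (Fin 6) → Q →L[ℂ] Q := fun w => w.foldr (fun i B => ops i ∘L B) (ContinuousLinearMap.id ℂ Q)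
  let D : Set Q := ⋃ w, word w '' S
  have hD : TopologicalSpace.IsSeparable D :=
    TopologicalSpace.IsSeparable.iUnion fun w => hS.image (word w).continuous
  refine ⟨(Submodule.span ℂ D).topologicalClosure, Submodule.isClosed_topologicalClosure _, ?_, ?_, ?_⟩
  · rw [Submodule.topologicalClosure_coe]
    exact (hD.span (R := ℂ)).closure
  · intro x hx
    apply Submodule.le_topologicalClosure
    apply Submodule.subset_span
    exact Set.mem_iUnion.2 ⟨[], x, hx, rfl⟩
  · intro i x hx
    have h1 : ∀ x ∈ Submodule.span ℂ D, ops i x ∈ Submodule.span ℂ D := by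
      have : Submodule.span ℂ D ≤ (Submodule.span ℂ D).comap (ops i : Q →ₗ[ℂ] Q) := by
        rw [Submodule.span_le]
        intro y hy
        obtain ⟨w, z, hz, rfl⟩ := Set.mem_iUnion.1 hy
        exact Submodule.subset_span (Set.mem_iUnion.2 ⟨i :: w, z, hz, rfl⟩)
      exact this
    have h2 : x ∈ closure (Submodule.span ℂ D : Set Q) := by
      rwa [← Submodule.topologicalClosure_coe]
    show ops i x ∈ ((Submodule.span ℂ D).topologicalClosure : Set Q)
    rw [Submodule.topologicalClosure_coe]
    exact map_mem_closure (ops i).continuous h2 h1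

lemma opRestrict_adjoint {Q : Type*} [NormedAddCommGroup Q] [InnerProductSpace ℂ Q] [CompleteSpace Q]
    (T : Q →L[ℂ] Q) (M : Submodule ℂ Q) [CompleteSpace M] (h : ∀ x ∈ M, T x ∈ M)
    (h' : ∀ x ∈ M, ContinuousLinearMap.adjoint T x ∈ M) :
    ContinuousLinearMap.adjoint (opRestrict T M h) = opRestrict (ContinuousLinearMap.adjoint T) M h' := by
  ext1 x
  apply ext_inner_left ℂ
  intro y
  rw [ContinuousLinearMap.adjoint_inner_right]
  show inner ℂ (T (y : Q)) (x : Q) = inner ℂ (y : Q) (ContinuousLinearMap.adjoint T (x : Q))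
  rw [ContinuousLinearMap.adjoint_inner_right]

lemma IsUP.equivs {H Q : Type*} [NormedAddCommGroup H] [InnerProductSpace ℂ H] [CompleteSpace H]
    [NormedAddCommGroup Q] [InnerProductSpace ℂ Q] [CompleteSpace Q]
    {mk : (ℕ →ᵇ H) →ₗ[ℂ] Q} (h : IsUP mk) (M : Submodule ℂ Q) [CompleteSpace M]
    [TopologicalSpace.SeparableSpace M] (hM : ∀ g, mk (BoundedContinuousFunction.const ℕ g) ∈ M)
    (T : H →L[ℂ] H) (B : Q →L[ℂ] Q) (hB : ∀ x y : ℕ →ᵇ H, (∀ n, y n = T (x n)) → B (mk x) = mk y)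
    (hBM : ∀ x ∈ M, B x ∈ M) (hBM' : ∀ x ∈ M, ContinuousLinearMap.adjoint B x ∈ M)
    (ε : ℝ) (hε : 0 < ε) :
    ∃ U : M ≃ₗᵢ[ℂ] H,
      IsCompactOperator (T ∘L (U.toContinuousLinearEquiv : M →L[ℂ] H) -
        (U.toContinuousLinearEquiv : M →L[ℂ] H) ∘L opRestrict B M hBM) ∧
      ‖T ∘L (U.toContinuousLinearEquiv : M →L[ℂ] H) -
        (U.toContinuousLinearEquiv : M →L[ℂ] H) ∘L opRestrict B M hBM‖ ≤ 9 * ε := by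
  have hB' := h.op_adj (fun _ => T) ‖T‖ (fun _ => le_rfl) B hB
  let cst : H → (ℕ →ᵇ H) := fun g => BoundedContinuousFunction.const ℕ g
  let ι : H →ₗᵢ[ℂ] M :=
    { toFun := fun g => ⟨mk (cst g), hM g⟩
      map_add' := fun a b => by
        apply Subtype.ext
        show mk (cst (a+b)) = mk (cst a) + mk (cst b)
        rw [← map_add]; rfl
      map_smul' := fun c a => by
        apply Subtype.ext
        show mk (cst (c • a)) = c • mk (cst a)
        rw [← map_smul]; rfl
      norm_map' := fun a => by
        show ‖mk (cst a)‖ = ‖a‖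
        exact tendsto_nhds_unique (h.norm (cst a)) (tendsto_const_nhds) }
  have hι : ∀ g, (ι g : Q) = mk (cst g) := fun g => rfl
  let X := opRestrict B M hBM
  have hXι : ∀ g, X (ι g) = ι (T g) := by
    intro g
    apply Subtype.ext
    show B (mk (cst g)) = mk (cst (T g))
    exact hB _ _ (fun n => rfl)
  have hXι' : ∀ g, ContinuousLinearMap.adjoint X (ι g) = ι (ContinuousLinearMap.adjoint T g) := by
    intro g
    rw [opRestrict_adjoint B M hBM hBM']
    apply Subtype.ext
    show ContinuousLinearMap.adjoint B (mk (cst g)) = mk (cst (ContinuousLinearMap.adjoint T g))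
    exact hB' _ _ (fun n => rfl)
  let E : Submodule ℂ M := (LinearMap.range ι.toLinearMap)ᗮ
  have memE : ∀ m : M, m ∈ E ↔ ∀ g, inner ℂ (ι g) m = 0 := by
    intro m
    rw [Submodule.mem_orthogonal]
    constructor
    · intro hh g; exact hh _ ⟨g, rfl⟩
    · rintro hh _ ⟨g, rfl⟩; exact hh g
  have hXE : ∀ m ∈ E, X m ∈ E := by
    intro m hm
    rw [memE] at hm ⊢
    intro g
    rw [← ContinuousLinearMap.adjoint_inner_left, hXι']; exact hm _
  have hXE' : ∀ m ∈ E, ContinuousLinearMap.adjoint X m ∈ E := by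
    intro m hm
    rw [memE] at hm ⊢
    intro g
    rw [ContinuousLinearMap.adjoint_inner_right, hXι]; exact hm _
  haveI : CompleteSpace E := inferInstance
  haveI : SecondCountableTopology M := UniformSpace.secondCountable_of_separable M
  haveI : TopologicalSpace.SeparableSpace E := inferInstance
  let κ : E →ₗᵢ[ℂ] M := E.subtypeₗᵢ
  let R : E →L[ℂ] E := opRestrict X E hXE
  have hRa : ContinuousLinearMap.adjoint R = opRestrict (ContinuousLinearMap.adjoint X) E hXE' :=
    opRestrict_adjoint X E hXE hXE'
  have hικ : ∀ g e, inner ℂ (ι g) (κ e) = 0 := fun g e => (memE _).1 e.2 g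
  have habs : OpAbsorbs T R := by
    refine h.absorbs (M.subtypeₗᵢ.comp κ) (fun g e => hικ g e) T R B hB (fun e => rfl) (fun e => ?_)
    rw [hRa]
    have : ContinuousLinearMap.adjoint X (e : M) = opRestrict (ContinuousLinearMap.adjoint B) M hBM' (e : M) := by
      rw [opRestrict_adjoint B M hBM hBM']
    show ContinuousLinearMap.adjoint B ((e : M) : Q) = ((ContinuousLinearMap.adjoint X (e : M) : M) : Q)
    rw [this]; rfl
  have hdec : ∀ m, ι (ContinuousLinearMap.adjoint ι.toContinuousLinearMap m) +
      κ (ContinuousLinearMap.adjoint κ.toContinuousLinearMap m) = m := by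
    intro m
    have he : m - ι (ContinuousLinearMap.adjoint ι.toContinuousLinearMap m) ∈ E := by
      rw [memE]
      intro g
      rw [inner_sub_right, ι.inner_map_map, ContinuousLinearMap.adjoint_inner_right]
      exact sub_self _
    have aki : ∀ x, ContinuousLinearMap.adjoint κ.toContinuousLinearMap (ι x) = 0 := by
      intro x
      apply ext_inner_left ℂ; intro y
      rw [ContinuousLinearMap.adjoint_inner_right, inner_zero_right, inner_eq_zero_symm]; exact hικ x y
    have e1 : ContinuousLinearMap.adjoint κ.toContinuousLinearMap m = ⟨_, he⟩ := by
      have := isom_adj_apply κ ⟨_, he⟩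
      rw [← this]
      show _ = ContinuousLinearMap.adjoint κ.toContinuousLinearMap (m - ι (ContinuousLinearMap.adjoint ι.toContinuousLinearMap m))
      rw [map_sub, aki, sub_zero]
    rw [e1]
    show _ + (m - _) = m
    abel
  exact absorb_unitary ι κ hικ hdec T R X hXι (fun e => rfl) habs ε hε

lemma conjOp_norm_le {H M : Type*} [NormedAddCommGroup H] [InnerProductSpace ℂ H]
    [NormedAddCommGroup M] [InnerProductSpace ℂ M] (J : M ≃ₗᵢ[ℂ] H) (X : M →L[ℂ] M) (c : ℝ) (hc : ‖X‖ ≤ c) :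
    ‖conjOp J X‖ ≤ c := by
  refine ContinuousLinearMap.opNorm_le_bound _ ((norm_nonneg _).trans hc) fun y => ?_
  show ‖J (X (J.symm y))‖ ≤ _
  rw [J.norm_map]
  refine (X.le_opNorm _).trans ?_
  rw [J.symm.norm_map]
  gcongr

lemma conj_defect {H M : Type*} [NormedAddCommGroup H] [InnerProductSpace ℂ H]
    [NormedAddCommGroup M] [InnerProductSpace ℂ M] (J U : M ≃ₗᵢ[ℂ] H) (X : M →L[ℂ] M) (T : H →L[ℂ] H)
    (c : ℝ) (h1 : IsCompactOperator (T ∘L (U.toContinuousLinearEquiv : M →L[ℂ] H) -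
        (U.toContinuousLinearEquiv : M →L[ℂ] H) ∘L X))
    (h2 : ‖T ∘L (U.toContinuousLinearEquiv : M →L[ℂ] H) -
        (U.toContinuousLinearEquiv : M →L[ℂ] H) ∘L X‖ ≤ c) :
    (IsCompactOperator (conjOp J X - conjOp (U.symm.trans J) T) ∧
      ‖conjOp J X - conjOp (U.symm.trans J) T‖ ≤ c) ∧
    (IsCompactOperator (T - conjOp (J.symm.trans U) (conjOp J X)) ∧
      ‖T - conjOp (J.symm.trans U) (conjOp J X)‖ ≤ c) := by
  set D := T ∘L (U.toContinuousLinearEquiv : M →L[ℂ] H) - (U.toContinuousLinearEquiv : M →L[ℂ] H) ∘L X with hD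
  have hDa : ∀ m, D m = T (U m) - U (X m) := fun m => rfl
  have hc : 0 ≤ c := (norm_nonneg _).trans h2
  let P : H →L[ℂ] H := ((U.symm.trans J).toContinuousLinearEquiv : H →L[ℂ] H)
  have e1 : conjOp J X - conjOp (U.symm.trans J) T =
      -(P ∘L D ∘L (J.symm.toContinuousLinearEquiv : H →L[ℂ] M)) := by
    ext y
    show J (X (J.symm y)) - J (U.symm (T (U (J.symm y)))) = - J (U.symm (D (J.symm y)))
    rw [hDa, map_sub, map_sub, U.symm_apply_apply]
    abel
  have e2 : T - conjOp (J.symm.trans U) (conjOp J X) = D ∘L (U.symm.toContinuousLinearEquiv : H →L[ℂ] M) := by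
    ext y
    show T y - U (J.symm (J (X (J.symm (J (U.symm y)))))) = D (U.symm y)
    rw [hDa, J.symm_apply_apply, J.symm_apply_apply, U.apply_symm_apply]
  refine ⟨⟨?_, ?_⟩, ⟨?_, ?_⟩⟩
  · rw [e1]
    exact ((h1.comp_clm (J.symm.toContinuousLinearEquiv : H →L[ℂ] M)).clm_comp P).neg
  · rw [e1, norm_neg]
    refine ContinuousLinearMap.opNorm_le_bound _ hc fun y => ?_
    show ‖(U.symm.trans J) (D (J.symm y))‖ ≤ _
    rw [LinearIsometryEquiv.norm_map]
    refine (D.le_opNorm _).trans ?_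
    rw [J.symm.norm_map]
    gcongr
  · rw [e2]
    exact h1.comp_clm (U.symm.toContinuousLinearEquiv : H →L[ℂ] M)
  · rw [e2]
    refine ContinuousLinearMap.opNorm_le_bound _ hc fun y => ?_
    show ‖D (U.symm y)‖ ≤ _
    refine (D.le_opNorm _).trans ?_
    rw [U.symm.norm_map]
    gcongr

lemma exists_norm_seq {H : Type*} [NormedAddCommGroup H] [InnerProductSpace ℂ H] [Nontrivial H]
    (T₁ T₂ : H →L[ℂ] H) (lam : ℝ) (h : T₂ ∈ closure (boundedSimOrbit T₁ lam)) :
    ∃ A B : ℕ → H →L[ℂ] H, (∀ n, ‖A n‖ ≤ lam) ∧ (∀ n, ‖B n‖ ≤ 1) ∧ (∀ n x, A n (B n x) = x) ∧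
      (∀ n x, B n (A n x) = x) ∧ Tendsto (fun n => A n ∘L T₁ ∘L B n) atTop (𝓝 T₂) := by
  obtain ⟨Z, hZ, hlim⟩ := mem_closure_iff_seq_limit.1 h
  choose S hS1 hS2 using hZ
  let c : ℕ → ℝ := fun n => ‖((S n).symm : H →L[ℂ] H)‖
  have hc : ∀ n, 0 < c n := fun n => (S n).symm.norm_pos
  have hc' : ∀ n, (c n : ℂ) ≠ 0 := fun n => by exact_mod_cast (hc n).ne'
  refine ⟨fun n => (c n : ℂ) • (S n : H →L[ℂ] H), fun n => (c n : ℂ)⁻¹ • ((S n).symm : H →L[ℂ] H),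
    ?_, ?_, ?_, ?_, ?_⟩
  · intro n
    rw [norm_smul, Complex.norm_real, Real.norm_of_nonneg (hc n).le, mul_comm]
    exact hS1 n
  · intro n
    rw [norm_smul, norm_inv, Complex.norm_real, Real.norm_of_nonneg (hc n).le]
    exact (inv_mul_cancel₀ (hc n).ne').le
  · intro n x
    show (c n : ℂ) • S n ((c n : ℂ)⁻¹ • (S n).symm x) = x
    rw [map_smul, smul_smul, mul_inv_cancel₀ (hc' n), one_smul, (S n).apply_symm_apply]
  · intro n x
    show (c n : ℂ)⁻¹ • (S n).symm ((c n : ℂ) • S n x) = x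
    rw [map_smul, smul_smul, inv_mul_cancel₀ (hc' n), one_smul, (S n).symm_apply_apply]
  · refine hlim.congr fun n => ?_
    rw [hS2]
    ext x
    show S n (T₁ ((S n).symm x)) = (c n : ℂ) • S n (T₁ ((c n : ℂ)⁻¹ • (S n).symm x))
    rw [map_smul, map_smul, smul_smul, mul_inv_cancel₀ (hc' n), one_smul]

end Assembly

/-- If `T₂` is a norm limit of operators `S T₁ S⁻¹` with `‖S‖ ‖S⁻¹‖ ≤ λ`, then
`T₁` is approximately unitarily equivalent to an operator `T₁'` that is `λ`-similar to an
operator `T₂'` that is approximately unitarily equivalent to `T₂`. -/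
theorem stmt14 {H : Type*} [NormedAddCommGroup H] [InnerProductSpace ℂ H] [CompleteSpace H]
    [TopologicalSpace.SeparableSpace H] (hinf : ¬ FiniteDimensional ℂ H)
    (T₁ T₂ : H →L[ℂ] H) (lam : ℝ) (hlam : 1 ≤ lam)
    (h : T₂ ∈ closure (boundedSimOrbit T₁ lam)) :
    ∃ T₁' T₂' : H →L[ℂ] H, ApproxUnitEquiv T₁ T₁' ∧
      T₂' ∈ boundedSimOrbit T₁' lam ∧ ApproxUnitEquiv T₂' T₂ := by
  have hnt : Nontrivial H := by
    by_contra hc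
    rw [not_nontrivial_iff_subsingleton] at hc
    exact hinf inferInstance
  obtain ⟨A, B, hA, hB, hAB, hBA, hlim⟩ := exists_norm_seq T₁ T₂ lam h
  obtain ⟨Q, _, _, _, mk, hmk⟩ := exists_ultrapower H
  have hup : IsUP mk := hmk
  obtain ⟨P₁, hP₁n, hP₁⟩ := hup.op (fun _ => T₁) ‖T₁‖ (fun _ => le_rfl)
  obtain ⟨P₂, hP₂n, hP₂⟩ := hup.op (fun _ => T₂) ‖T₂‖ (fun _ => le_rfl)
  obtain ⟨S, hSn, hS⟩ := hup.op A lam hA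
  obtain ⟨R, hRn, hR⟩ := hup.op B 1 hB
  have hSR : ∀ q, S (R q) = q := by
    intro q
    obtain ⟨x, rfl⟩ := hup.1 q
    rw [hR x (bcfMap B 1 hB x) (fun n => rfl)]
    exact hS _ _ (fun n => (hAB n (x n)).symm)
  have hRS : ∀ q, R (S q) = q := by
    intro q
    obtain ⟨x, rfl⟩ := hup.1 q
    rw [hS x (bcfMap A lam hA x) (fun n => rfl)]
    exact hR _ _ (fun n => (hBA n (x n)).symm)
  have hP : ∀ q, P₂ q = S (P₁ (R q)) := by
    intro q
    obtain ⟨x, rfl⟩ := hup.1 q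
    rw [hR x (bcfMap B 1 hB x) (fun n => rfl),
      hP₁ _ (bcfMap (fun _ => T₁) ‖T₁‖ (fun _ => le_rfl) (bcfMap B 1 hB x)) (fun n => rfl),
      hS _ (bcfMap A lam hA _) (fun n => rfl),
      hP₂ x (bcfMap (fun _ => T₂) ‖T₂‖ (fun _ => le_rfl) x) (fun n => rfl), hup.eq_iff]
    have h1 : Tendsto (fun n => ‖T₂ - A n ∘L T₁ ∘L B n‖ * ‖x‖) (hyperfilter ℕ : Filter ℕ) (𝓝 0) := by
      have h2 := (tendsto_const_nhds (x := T₂)).sub hlim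
      rw [sub_self] at h2
      have h3 := (h2.norm.mul_const ‖x‖).mono_left Nat.hyperfilter_le_atTop
      rwa [norm_zero, zero_mul] at h3
    refine squeeze_zero_norm (fun n => ?_) h1
    have := ((T₂ - A n ∘L T₁ ∘L B n).le_opNorm (x n)).trans
      (mul_le_mul_of_nonneg_left (x.norm_coe_le_norm n) (norm_nonneg _))
    exact this
  have hsep : TopologicalSpace.IsSeparable
      (Set.range (fun g : H => mk (BoundedContinuousFunction.const ℕ g))) := by
    apply TopologicalSpace.isSeparable_range
    have hn : ∀ x : H, ‖mk (BoundedContinuousFunction.const ℕ x)‖ = ‖x‖ := fun x =>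
      (tendsto_nhds_unique (hup.norm (BoundedContinuousFunction.const ℕ x)) tendsto_const_nhds)
    let L : H →ₗ[ℂ] Q :=
      { toFun := fun g => mk (BoundedContinuousFunction.const ℕ g)
        map_add' := fun x y => by rw [← map_add]; rfl
        map_smul' := fun c x => by rw [RingHom.id_apply, ← map_smul]; rfl }
    let L' : H →ₗᵢ[ℂ] Q := ⟨L, hn⟩
    exact L'.continuous
  obtain ⟨M, hMc, hMs, hMr, hMi⟩ := exists_sep_invariant
    ![P₁, ContinuousLinearMap.adjoint P₁, P₂, ContinuousLinearMap.adjoint P₂, S, R] _ hsep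
  have i1 : ∀ x ∈ M, P₁ x ∈ M := hMi 0
  have i2 : ∀ x ∈ M, ContinuousLinearMap.adjoint P₁ x ∈ M := hMi 1
  have i3 : ∀ x ∈ M, P₂ x ∈ M := hMi 2
  have i4 : ∀ x ∈ M, ContinuousLinearMap.adjoint P₂ x ∈ M := hMi 3
  have i5 : ∀ x ∈ M, S x ∈ M := hMi 4
  have i6 : ∀ x ∈ M, R x ∈ M := hMi 5
  have : CompleteSpace M := hMc.completeSpace_coe
  have : TopologicalSpace.SeparableSpace M := hMs.separableSpace
  have hM : ∀ g, mk (BoundedContinuousFunction.const ℕ g) ∈ M := fun g => hMr ⟨g, rfl⟩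
  have hpos : ∀ n : ℕ, (0 : ℝ) < 1 / ((n : ℝ) + 1) := fun n => by positivity
  choose U1 hU1 hU1' using fun n : ℕ => hup.equivs M hM T₁ P₁ hP₁ i1 i2 _ (hpos n)
  choose U2 hU2 hU2' using fun n : ℕ => hup.equivs M hM T₂ P₂ hP₂ i3 i4 _ (hpos n)
  let J := U1 0
  have hz : Tendsto (fun n : ℕ => 9 * (1 / ((n : ℝ) + 1))) atTop (𝓝 0) := by
    have := (tendsto_one_div_add_atTop_nhds_zero_nat (𝕜 := ℝ)).const_mul 9
    rwa [mul_zero] at this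
  have rn : ∀ (X : Q →L[ℂ] Q) (hX : ∀ x ∈ M, X x ∈ M) (c : ℝ), ‖X‖ ≤ c → ‖opRestrict X M hX‖ ≤ c := by
    intro X hX c hc
    refine ContinuousLinearMap.opNorm_le_bound _ ((norm_nonneg _).trans hc) fun y => ?_
    exact (X.le_opNorm (y : Q)).trans (mul_le_mul_of_nonneg_right hc (norm_nonneg _))
  refine ⟨conjOp J (opRestrict P₁ M i1), conjOp J (opRestrict P₂ M i3), ?_, ?_, ?_⟩
  · refine ⟨fun n => (U1 n).symm.trans J, fun n => ?_, ?_⟩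
    · exact (conj_defect J (U1 n) _ _ _ (hU1 n) (hU1' n)).1.1
    · exact squeeze_zero (fun n => norm_nonneg _)
        (fun n => (conj_defect J (U1 n) _ _ _ (hU1 n) (hU1' n)).1.2) hz
  · let E : H ≃L[ℂ] H := ContinuousLinearEquiv.equivOfInverse
      (conjOp J (opRestrict S M i5)) (conjOp J (opRestrict R M i6))
      (fun x => by
        show J (opRestrict R M i6 (J.symm (J (opRestrict S M i5 (J.symm x))))) = x
        rw [J.symm_apply_apply]
        have : opRestrict R M i6 (opRestrict S M i5 (J.symm x)) = J.symm x := Subtype.ext (hRS _)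
        rw [this, J.apply_symm_apply])
      (fun x => by
        show J (opRestrict S M i5 (J.symm (J (opRestrict R M i6 (J.symm x))))) = x
        rw [J.symm_apply_apply]
        have : opRestrict S M i5 (opRestrict R M i6 (J.symm x)) = J.symm x := Subtype.ext (hSR _)
        rw [this, J.apply_symm_apply])
    refine ⟨E, ?_, ?_⟩
    · have e1 : ‖(E : H →L[ℂ] H)‖ ≤ lam := conjOp_norm_le J _ _ (rn S i5 lam hSn)
      have e2 : ‖(E.symm : H →L[ℂ] H)‖ ≤ 1 := conjOp_norm_le J _ _ (rn R i6 1 hRn)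
      calc _ ≤ lam * 1 := mul_le_mul e1 e2 (norm_nonneg _) (by linarith)
        _ = lam := mul_one _
    · ext x
      show J (opRestrict P₂ M i3 (J.symm x)) = J (opRestrict S M i5 (J.symm (J (opRestrict P₁ M i1
        (J.symm (J (opRestrict R M i6 (J.symm x))))))))
      rw [J.symm_apply_apply, J.symm_apply_apply]
      congr 1
      exact Subtype.ext (hP _)
  · refine ⟨fun n => J.symm.trans (U2 n), fun n => ?_, ?_⟩
    · exact (conj_defect J (U2 n) _ _ _ (hU2 n) (hU2' n)).2.1
    · exact squeeze_zero (fun n => norm_nonneg _)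
        (fun n => (conj_defect J (U2 n) _ _ _ (hU2 n) (hU2' n)).2.2) hz
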